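/- Let χ and ν be distinct Dirichlet characters modulo q. Then, unconditionally, |∫_T^{2T} L(1/2+it, χ)² · conj(L(1/2+it, ν))² dt| ≪_q T(log T)², where conj denotes complex conjugation. -/

import Mathlib

open Complex Filter MeasureTheory Finset HurwitzZeta
open scoped ArithmeticFunction Real Classical

noncomputable section

/-- The finite set of primes `p ≤ X`. -/
def primesUpTo (X : ℝ) : Finset ℕ :=
  (Finset.range (Nat.floor X + 1)).filter (fun p => p.Prime ∧ (p : ℝ) ≤ X)

/-- The finite set of naturals `n ≤ X`. -/
def natsUpTo (X : ℝ) : Finset ℕ :=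
  (Finset.range (Nat.floor X + 1)).filter (fun n => (n : ℝ) ≤ X)

/-- Truncated Euler product `P_X(s,χ)`, defined via the primitive character `χ*` inducing `χ`:
`P_X(s,χ) = ∏_{p ∣ q} (1 - χ*(p) p^{-s}) · exp(∑_{n ≤ X} χ*(n) Λ(n) / (n^s log n))`. -/
def PX {q : ℕ} (X : ℝ) (χ : DirichletCharacter ℂ q) (s : ℂ) : ℂ :=
  (∏ p ∈ q.primeFactors, (1 - χ.primitiveCharacter ((p : ℕ) : ZMod χ.conductor) * (p : ℂ) ^ (-s))) *
    Complex.exp (∑ n ∈ natsUpTo X,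
      χ.primitiveCharacter ((n : ℕ) : ZMod χ.conductor) * (Λ n : ℂ) / ((n : ℂ) ^ s * (Real.log n : ℂ)))

/-- `𝓟_X^ℓ(s) = ∏_χ P_X(s,χ)^{ℓ_χ}`. -/
def PXl {q : ℕ} (X : ℝ) (ℓ : DirichletCharacter ℂ q → ℕ) (s : ℂ) : ℂ :=
  ∏ χ : DirichletCharacter ℂ q, (PX X χ s) ^ (ℓ χ)

/-- A Dirichlet character as an arithmetic function. -/
def chiArith {q : ℕ} (χ : DirichletCharacter ℂ q) : ArithmeticFunction ℂ :=
  ⟨fun n => if n = 0 then 0 else χ ((n : ℕ) : ZMod q), by simp⟩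

/-- `d_ℓ`, the coefficients of the Dirichlet series of `𝓛^ℓ(s) = ∏_χ L(s,χ)^{ℓ_χ}`,
i.e. the Dirichlet convolution product `∏_χ χ^{*ℓ_χ}`. -/
def dcoef {q : ℕ} (ℓ : DirichletCharacter ℂ q → ℕ) : ArithmeticFunction ℂ :=
  ∏ χ : DirichletCharacter ℂ q, (chiArith χ) ^ (ℓ χ)

/-- `P*_X(s,χ) = ∏_{p ≤ X}(1 − χ(p)p^{−s})^{−1} · ∏_{√X < p ≤ X}(1 + χ(p)²/(2p^{2s}))^{−1}`. -/
def PstarX {q : ℕ} (X : ℝ) (χ : DirichletCharacter ℂ q) (s : ℂ) : ℂ :=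
  ((primesUpTo X).prod (fun p : ℕ => (1 - χ ((p : ℕ) : ZMod q) * (p : ℂ) ^ (-s))⁻¹)) *
    ((primesUpTo X).filter (fun p : ℕ => Real.sqrt X < (p : ℝ))).prod
      (fun p : ℕ => (1 + χ ((p : ℕ) : ZMod q) ^ 2 / (2 * (p : ℂ) ^ (2 * s)))⁻¹)

/-- `𝓟*_X^ℓ(s) = ∏_χ P*_X(s,χ)^{ℓ_χ}`. -/
def PstarXl {q : ℕ} (X : ℝ) (ℓ : DirichletCharacter ℂ q → ℕ) (s : ℂ) : ℂ :=
  ∏ χ : DirichletCharacter ℂ q, (PstarX X χ s) ^ (ℓ χ)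

/-- `Q_X(s,χ) = ∏_{p ≤ √X}(1 − χ(p)p^{−s}) · ∏_{√X < p ≤ X}(1 − χ(p)p^{−s} + χ(p)²/(2p^{2s}))`. -/
def QX {q : ℕ} (X : ℝ) (χ : DirichletCharacter ℂ q) (s : ℂ) : ℂ :=
  (((primesUpTo X).filter (fun p : ℕ => (p : ℝ) ≤ Real.sqrt X)).prod
      (fun p : ℕ => 1 - χ ((p : ℕ) : ZMod q) * (p : ℂ) ^ (-s))) *
    ((primesUpTo X).filter (fun p : ℕ => Real.sqrt X < (p : ℝ))).prod
      (fun p : ℕ => 1 - χ ((p : ℕ) : ZMod q) * (p : ℂ) ^ (-s)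
        + χ ((p : ℕ) : ZMod q) ^ 2 / (2 * (p : ℂ) ^ (2 * s)))

/-- `𝓠_X^ℓ(s) = ∏_χ Q_X(s,χ)^{ℓ_χ}`. -/
def QXl {q : ℕ} (X : ℝ) (ℓ : DirichletCharacter ℂ q → ℕ) (s : ℂ) : ℂ :=
  ∏ χ : DirichletCharacter ℂ q, (QX X χ s) ^ (ℓ χ)

/-- `𝓛^ℓ(s) = ∏_χ L(s,χ)^{ℓ_χ}`. -/
def Ll {q : ℕ} [NeZero q] (ℓ : DirichletCharacter ℂ q → ℕ) (s : ℂ) : ℂ :=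
  ∏ χ : DirichletCharacter ℂ q, (DirichletCharacter.LFunction χ s) ^ (ℓ χ)

/-- GRH for the Dirichlet L-functions modulo `q`: every zero `ρ` of `L(s,χ)` with
`0 < Re ρ < 1` satisfies `Re ρ = 1/2`. -/
def GRHmod (q : ℕ) [NeZero q] : Prop :=
  ∀ χ : DirichletCharacter ℂ q, ∀ ρ : ℂ,
    DirichletCharacter.LFunction χ ρ = 0 → 0 < ρ.re → ρ.re < 1 → ρ.re = 1 / 2

end

/-- A function of at most exponential growth in the strip `-1/2 ≤ Re s ≤ 3/2`. -/
def StripExpBounded (f : ℂ → ℂ) : Prop :=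
  ∃ C : ℝ, ∀ s : ℂ, -1 / 2 ≤ s.re → s.re ≤ 3 / 2 → ‖f s‖ ≤ C * Real.exp (C * |s.im|)

namespace StripExpBounded

lemma mono_const {C D x : ℝ} (h : C ≤ D) (hx : 0 ≤ x) (hD : 0 ≤ D) :
    C * Real.exp (C * x) ≤ D * Real.exp (D * x) := by
  gcongr

lemma exists_nonneg {f : ℂ → ℂ} (hf : StripExpBounded f) :
    ∃ C : ℝ, 0 ≤ C ∧ ∀ s : ℂ, -1 / 2 ≤ s.re → s.re ≤ 3 / 2 →
      ‖f s‖ ≤ C * Real.exp (C * |s.im|) := by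
  obtain ⟨C, hC⟩ := hf
  exact ⟨max C 0, le_max_right _ _, fun s h1 h2 ↦ (hC s h1 h2).trans
    (mono_const (le_max_left _ _) (abs_nonneg _) (le_max_right _ _))⟩

lemma of_bounded {f : ℂ → ℂ} {C : ℝ}
    (hC : ∀ s : ℂ, -1 / 2 ≤ s.re → s.re ≤ 3 / 2 → ‖f s‖ ≤ C) : StripExpBounded f := by
  refine ⟨max C 0, fun s h1 h2 ↦ (hC s h1 h2).trans ?_⟩
  have : 1 ≤ Real.exp (max C 0 * |s.im|) := Real.one_le_exp (by positivity)
  nlinarith [le_max_left C 0, le_max_right C 0]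

lemma mul {f g : ℂ → ℂ} (hf : StripExpBounded f) (hg : StripExpBounded g) :
    StripExpBounded (fun s ↦ f s * g s) := by
  obtain ⟨C, hC0, hC⟩ := hf.exists_nonneg
  obtain ⟨D, hD0, hD⟩ := hg.exists_nonneg
  refine ⟨max (C * D) (C + D), fun s h1 h2 ↦ ?_⟩
  rw [norm_mul]
  calc ‖f s‖ * ‖g s‖ ≤ (C * Real.exp (C * |s.im|)) * (D * Real.exp (D * |s.im|)) := by
        gcongr
        exacts [hC s h1 h2, hD s h1 h2]
    _ = (C * D) * Real.exp ((C + D) * |s.im|) := by rw [add_mul, Real.exp_add]; ring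
    _ ≤ _ := by
        gcongr
        exacts [le_max_left _ _, le_max_right _ _]

lemma add {f g : ℂ → ℂ} (hf : StripExpBounded f) (hg : StripExpBounded g) :
    StripExpBounded (fun s ↦ f s + g s) := by
  obtain ⟨C, hC0, hC⟩ := hf.exists_nonneg
  obtain ⟨D, hD0, hD⟩ := hg.exists_nonneg
  refine ⟨C + D, fun s h1 h2 ↦ (norm_add_le _ _).trans ?_⟩
  rw [add_mul]
  refine add_le_add ((hC s h1 h2).trans ?_) ((hD s h1 h2).trans ?_) <;> gcongr <;> linarith

lemma neg {f : ℂ → ℂ} (hf : StripExpBounded f) : StripExpBounded (fun s ↦ -f s) := by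
  simpa [StripExpBounded] using hf

lemma sub {f g : ℂ → ℂ} (hf : StripExpBounded f) (hg : StripExpBounded g) :
    StripExpBounded (fun s ↦ f s - g s) := by
  simpa [sub_eq_add_neg] using hf.add hg.neg

lemma const (c : ℂ) : StripExpBounded (fun _ ↦ c) :=
  of_bounded (C := ‖c‖) fun _ _ _ ↦ le_rfl

lemma sum {ι : Type*} (t : Finset ι) {f : ι → ℂ → ℂ} (hf : ∀ i ∈ t, StripExpBounded (f i)) :
    StripExpBounded (fun s ↦ ∑ i ∈ t, f i s) := by
  induction t using Finset.cons_induction with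
  | empty => simpa using const 0
  | cons a t ha ih =>
    simp only [Finset.sum_cons]
    exact (hf a (by simp)).add (ih fun i hi ↦ hf i (by simp [hi]))

lemma id : StripExpBounded (fun s ↦ s) := by
  refine ⟨2, fun s h1 h2 ↦ (Complex.norm_le_abs_re_add_abs_im s).trans ?_⟩
  have h : |s.re| ≤ 3 / 2 := abs_le.2 ⟨by linarith, h2⟩
  have := Real.add_one_le_exp (2 * |s.im|)
  linarith [abs_nonneg s.im]

lemma const_cpow {a : ℝ} (ha : 0 < a) (b c : ℝ) :
    StripExpBounded (fun s ↦ (a : ℂ) ^ (b + c * s : ℂ)) := by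
  have hcont : Continuous fun x : ℝ ↦ a ^ (b + c * x) := by
    have := ha.ne'
    fun_prop (disch := simpa)
  obtain ⟨C, hC⟩ := (isCompact_Icc (a := (-1 / 2 : ℝ)) (b := 3 / 2)).exists_bound_of_continuousOn
    hcont.continuousOn
  refine of_bounded (C := C) fun s h1 h2 ↦ ?_
  rw [norm_cpow_eq_rpow_re_of_pos ha]
  simpa using (le_abs_self _).trans (hC s.re ⟨h1, h2⟩)

/-- It suffices to check exponential growth away from the real axis. -/
lemma of_continuous {f g : ℂ → ℂ} (hf : Continuous f) (hg : StripExpBounded g)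
    (h : ∀ s : ℂ, -1 / 2 ≤ s.re → s.re ≤ 3 / 2 → 1 ≤ |s.im| → ‖f s‖ ≤ ‖g s‖) :
    StripExpBounded f := by
  obtain ⟨C, hC0, hC⟩ := hg.exists_nonneg
  obtain ⟨D, hD⟩ := ((isCompact_Icc (a := (-1 / 2 : ℝ)) (b := 3 / 2)).reProdIm
    (isCompact_Icc (a := (-1 : ℝ)) (b := 1))).exists_bound_of_continuousOn hf.continuousOn
  refine ⟨max C D, fun s h1 h2 ↦ ?_⟩
  have hm : 0 ≤ max C D := hC0.trans (le_max_left _ _)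
  rcases le_total 1 |s.im| with h3 | h3
  · exact ((h s h1 h2 h3).trans (hC s h1 h2)).trans
      (mono_const (le_max_left _ _) (abs_nonneg _) hm)
  · refine (hD s (mem_reProdIm.2 ⟨⟨h1, h2⟩, abs_le.1 h3⟩)).trans ((le_max_right C D).trans ?_)
    have : 1 ≤ Real.exp (max C D * |s.im|) := Real.one_le_exp (by positivity)
    nlinarith

end StripExpBounded

/-- Mellin transforms are bounded in closed vertical strips of convergence. -/
lemma exists_norm_mellin_le {f : ℝ → ℂ} {a b : ℝ} (ha : MellinConvergent f a)
    (hb : MellinConvergent f b) :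
    ∃ C : ℝ, ∀ s : ℂ, a ≤ s.re → s.re ≤ b → ‖mellin f s‖ ≤ C := by
  refine ⟨∫ t in Set.Ioi (0 : ℝ),
    (‖(t : ℂ) ^ ((a : ℂ) - 1) • f t‖ + ‖(t : ℂ) ^ ((b : ℂ) - 1) • f t‖), fun s h1 h2 ↦ ?_⟩
  refine norm_integral_le_of_norm_le (ha.norm.add hb.norm) ?_
  filter_upwards [ae_restrict_mem measurableSet_Ioi] with t ht
  have ht : 0 < t := ht
  simp only [norm_smul, norm_cpow_eq_rpow_re_of_pos ht, sub_re, ofReal_re, one_re, ← add_mul]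
  gcongr
  rcases le_total t 1 with h | h
  · have := Real.rpow_le_rpow_of_exponent_ge ht h (by linarith : a - 1 ≤ s.re - 1)
    have := Real.rpow_nonneg ht.le (b - 1)
    linarith
  · have := Real.rpow_le_rpow_of_exponent_le h (by linarith : s.re - 1 ≤ b - 1)
    have := Real.rpow_nonneg ht.le (a - 1)
    linarith

lemma exists_norm_Gamma_le {a b : ℝ} (ha : 0 < a) (hab : a ≤ b) :
    ∃ C : ℝ, ∀ s : ℂ, a ≤ s.re → s.re ≤ b → ‖Complex.Gamma s‖ ≤ C := by
  have key : ∀ c : ℝ, 0 < c → MellinConvergent (fun x : ℝ ↦ ((Real.exp (-x) : ℝ) : ℂ)) c := by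
    intro c hc
    have := Complex.GammaIntegral_convergent (s := c) (by simpa using hc)
    refine this.congr_fun (fun t _ ↦ ?_) measurableSet_Ioi
    simp [mul_comm]
  obtain ⟨C, hC⟩ := exists_norm_mellin_le (key a ha) (key b (ha.trans_le hab))
  refine ⟨C, fun s h1 h2 ↦ ?_⟩
  rw [Complex.Gamma_eq_integral (ha.trans_le h1), Complex.GammaIntegral_eq_mellin]
  exact hC s h1 h2

lemma stripExpBounded_Gammaℝ_sub {b : ℝ} (hb : 3 / 2 < b) :
    StripExpBounded (fun s ↦ Gammaℝ (b - s)) := by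
  obtain ⟨C, hC⟩ := exists_norm_Gamma_le (a := (b - 3 / 2) / 2) (b := (b + 1 / 2) / 2)
    (by linarith) (by linarith)
  simp only [Gammaℝ_def]
  refine StripExpBounded.mul ?_ (.of_bounded (C := C) fun s h1 h2 ↦ hC _ ?_ ?_)
  · convert! StripExpBounded.const_cpow Real.pi_pos (-b / 2) (1 / 2) using 3
    push_cast; ring
  all_goals
    rw [Complex.div_ofNat_re]
    simp
    linarith

lemma norm_cos_le_exp_abs_im (z : ℂ) : ‖Complex.cos z‖ ≤ Real.exp |z.im| := by
  rw [Complex.cos, norm_div, Complex.norm_ofNat]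
  have h1 : ‖Complex.exp (z * I)‖ ≤ Real.exp |z.im| := by
    rw [Complex.norm_exp]; simpa using neg_le_abs _
  have h2 : ‖Complex.exp (-z * I)‖ ≤ Real.exp |z.im| := by
    rw [Complex.norm_exp]; simpa using le_abs_self _
  have := norm_add_le (Complex.exp (z * I)) (Complex.exp (-z * I))
  linarith

lemma stripExpBounded_cos (b : ℝ) : StripExpBounded (fun s ↦ Complex.cos (π * (s + b) / 2)) := by
  refine ⟨π, fun s _ _ ↦ (norm_cos_le_exp_abs_im _).trans ?_⟩
  have : (π * (s + b) / 2 : ℂ).im = π * s.im / 2 := by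
    rw [Complex.div_ofNat_im]; simp
  rw [this, abs_div, abs_mul, abs_of_pos Real.pi_pos, abs_two]
  have h1 : Real.exp (π * |s.im| / 2) ≤ Real.exp (π * |s.im|) := by
    gcongr
    have : 0 ≤ π * |s.im| := by positivity
    linarith
  have := Real.pi_gt_three
  nlinarith [Real.exp_pos (π * |s.im|)]

lemma inv_Gammaℝ_eq {w : ℂ} (hw : w.re < 2) :
    (Gammaℝ w)⁻¹ = Gammaℝ (2 - w) * Complex.cos (π * (w - 1) / 2) := by
  have h := Gammaℝ_one_sub_mul_Gammaℝ_one_add (w - 1)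
  rw [show 1 - (w - 1) = 2 - w by ring, show 1 + (w - 1) = w by ring] at h
  have h2 : Gammaℝ (2 - w) ≠ 0 := Gammaℝ_ne_zero_of_re_pos (by simpa using hw)
  rw [← inv_inv (Complex.cos _), ← h]
  field_simp

lemma stripExpBounded_inv_Gammaℝ : StripExpBounded (fun s ↦ (Gammaℝ s)⁻¹) := by
  have := (stripExpBounded_Gammaℝ_sub (b := 2) (by norm_num)).mul (stripExpBounded_cos (-1))
  obtain ⟨C, hC⟩ := this
  refine ⟨C, fun s h1 h2 ↦ ?_⟩
  beta_reduce
  rw [inv_Gammaℝ_eq (by linarith)]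
  simpa [sub_eq_add_neg] using hC s h1 h2

lemma stripExpBounded_inv_Gammaℝ_add_one : StripExpBounded (fun s ↦ (Gammaℝ (s + 1))⁻¹) := by
  have h := ((stripExpBounded_Gammaℝ_sub (b := 3) (by norm_num)).mul
    (stripExpBounded_cos (-2))).mul (.const (2 * π))
  refine .of_continuous (differentiable_Gammaℝ_inv.continuous.comp (by fun_prop)) h ?_
  intro s h1 h2 h3
  have hs : s - 1 ≠ 0 := by
    intro h
    have := congrArg Complex.im h
    simp at this
    norm_num [this] at h3
  have hge : 1 ≤ ‖s - 1‖ := h3.trans (by simpa using Complex.abs_im_le_norm (s - 1))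
  have h4 := Gammaℝ_add_two hs
  rw [show s - 1 + 2 = s + 1 by ring] at h4
  have h5 : (Gammaℝ (s + 1))⁻¹ = (Gammaℝ (s - 1))⁻¹ * (2 * π) / (s - 1) := by
    rw [h4]; field_simp
  rw [h5, inv_Gammaℝ_eq (by simp; linarith), norm_div]
  refine (div_le_self (norm_nonneg _) hge).trans (le_of_eq ?_)
  simp only [ofReal_neg, ofReal_ofNat]
  ring_nf

lemma exists_norm_Λ₀_le (P : WeakFEPair ℂ) (a b : ℝ) :
    ∃ C : ℝ, ∀ s : ℂ, a ≤ s.re → s.re ≤ b → ‖P.Λ₀ s‖ ≤ C :=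
  exists_norm_mellin_le (f := P.f_modif)
    (P.isStrongFEPair_toStrongFEPair.hasMellin a).1
    (P.isStrongFEPair_toStrongFEPair.hasMellin b).1

lemma stripExpBounded_completedHurwitzZetaEven₀ (a : UnitAddCircle) :
    StripExpBounded (completedHurwitzZetaEven₀ a) := by
  obtain ⟨C, hC⟩ := exists_norm_Λ₀_le (hurwitzEvenFEPair a) (-1 / 4) (3 / 4)
  refine .of_bounded (C := C / 2) fun s h1 h2 ↦ ?_
  rw [completedHurwitzZetaEven₀, norm_div, Complex.norm_ofNat]
  gcongr
  apply hC <;> rw [Complex.div_ofNat_re] <;> linarith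

lemma stripExpBounded_completedHurwitzZetaOdd (a : UnitAddCircle) :
    StripExpBounded (completedHurwitzZetaOdd a) := by
  have hP := isStrong_hurwitzOddFEPair a
  obtain ⟨C, hC⟩ := exists_norm_mellin_le (hP.hasMellin (1 / 4 : ℝ)).1 (hP.hasMellin (5 / 4 : ℝ)).1
  refine .of_bounded (C := C / 2) fun s h1 h2 ↦ ?_
  rw [completedHurwitzZetaOdd, norm_div, Complex.norm_ofNat, hP.Λ_eq]
  gcongr
  apply hC <;> rw [Complex.div_ofNat_re, add_re, one_re] <;> linarith

lemma stripExpBounded_natCast_cpow_neg (N : ℕ) [NeZero N] :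
    StripExpBounded (fun s ↦ (N : ℂ) ^ (-s)) := by
  have := StripExpBounded.const_cpow (a := N) (by exact_mod_cast NeZero.pos N) 0 (-1)
  simpa using this

lemma stripExpBounded_completedLFunction₀ {N : ℕ} [NeZero N] (Φ : ZMod N → ℂ) :
    StripExpBounded (ZMod.completedLFunction₀ Φ) := by
  refine .add ?_ ?_ <;> refine (stripExpBounded_natCast_cpow_neg N).mul (.sum _ fun i _ ↦ ?_)
  · exact (StripExpBounded.const _).mul (stripExpBounded_completedHurwitzZetaEven₀ _)
  · exact (StripExpBounded.const _).mul (stripExpBounded_completedHurwitzZetaOdd _)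

lemma stripExpBounded_inv_gammaFactor {N : ℕ} (χ : DirichletCharacter ℂ N) :
    StripExpBounded (fun s ↦ (χ.gammaFactor s)⁻¹) := by
  rcases χ.even_or_odd with h | h
  · simpa only [h.gammaFactor_def] using stripExpBounded_inv_Gammaℝ
  · simpa only [h.gammaFactor_def] using stripExpBounded_inv_Gammaℝ_add_one

/-- The function `(s - 1) L(s, χ)` extends to an entire function of at most exponential growth
in the critical strip. -/
lemma exists_entire_sub_one_mul_LFunction {N : ℕ} [NeZero N] (χ : DirichletCharacter ℂ N) :
    ∃ E : ℂ → ℂ, Differentiable ℂ E ∧ (∀ s ≠ 1, E s = (s - 1) * χ.LFunction s) ∧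
      StripExpBounded E := by
  obtain ⟨E, hE, hEs⟩ :
      ∃ E : ℂ → ℂ, Differentiable ℂ E ∧ ∀ s ≠ 1, E s = (s - 1) * χ.LFunction s := by
    by_cases hχ : χ = 1
    · subst hχ
      exact ⟨_, DirichletCharacter.differentiable_LFunctionTrivChar₁ N, fun s hs ↦ by
        simp [hs, DirichletCharacter.LFunctionTrivChar]⟩
    · exact ⟨fun s ↦ (s - 1) * χ.LFunction s,
        (differentiable_id.sub_const 1).mul (DirichletCharacter.differentiable_LFunction hχ),
        fun s _ ↦ rfl⟩
  refine ⟨E, hE, hEs, ?_⟩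
  have hinv : ∀ c : ℂ, c.im = 0 →
      StripExpBounded (fun s ↦ if 1 ≤ |s.im| then (s - c)⁻¹ else 0) := by
    intro c hc
    refine .of_bounded (C := 1) fun s _ _ ↦ ?_
    split_ifs with h
    · rw [norm_inv]
      refine inv_le_one_of_one_le₀ (h.trans ?_)
      simpa [hc] using Complex.abs_im_le_norm (s - c)
    · simp
  have hN := stripExpBounded_natCast_cpow_neg N
  have hg := ((StripExpBounded.id.sub (.const 1)).mul
    (((stripExpBounded_completedLFunction₀ (χ ·)).sub
      ((hN.mul (.const (χ 0))).mul (hinv 0 (by simp)))).add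
      ((hN.mul (.const (∑ j, χ j))).mul (hinv 1 (by simp))))).mul
    (stripExpBounded_inv_gammaFactor χ)
  refine .of_continuous hE.continuous hg fun s _ _ h ↦ le_of_eq ?_
  have h0 : s ≠ 0 := by rintro rfl; norm_num at h
  have h1 : s ≠ 1 := by rintro rfl; norm_num at h
  rw [hEs s h1, χ.LFunction_eq_completed_div_gammaFactor s (.inl h0),
    DirichletCharacter.completedLFunction, ZMod.completedLFunction_eq]
  simp only [h, if_true, sub_zero]
  congr 1
  rw [show (s - 1)⁻¹ = -(1 - s)⁻¹ by rw [← neg_sub, neg_inv]]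
  ring

lemma norm_Gammaℝ_eq_of_conj {s w : ℂ} (h : w = starRingEnd ℂ s) : ‖Gammaℝ w‖ = ‖Gammaℝ s‖ := by
  subst h
  have h2 : (starRingEnd ℂ s) / 2 = starRingEnd ℂ (s / 2) := by simp [map_ofNat]
  rw [Gammaℝ_def, Gammaℝ_def, norm_mul, norm_mul, h2, Complex.Gamma_conj, RCLike.norm_conj,
    norm_cpow_eq_rpow_re_of_pos Real.pi_pos, norm_cpow_eq_rpow_re_of_pos Real.pi_pos]
  simp

lemma differentiableAt_Gammaℝ_sub {b : ℝ} {s : ℂ} (h : s.re < b) :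
    DifferentiableAt ℂ (fun s ↦ Gammaℝ (b - s)) s := by
  have h1 : DifferentiableAt ℂ (fun s : ℂ ↦ (Gammaℝ (b - s))⁻¹) s :=
    (differentiable_Gammaℝ_inv (b - s)).comp s (by fun_prop)
  have h2 := h1.fun_inv (inv_ne_zero (Gammaℝ_ne_zero_of_re_pos (by simpa using h)))
  simpa using h2

/-- The factor `(s - 1) γ(1 - s) / γ(s)` of the functional equation of an even primitive character,
with its removable singularity at `s = 1` removed. -/
noncomputable def evenFactor (s : ℂ) : ℂ := -(2 * π) * Gammaℝ (3 - s) * (Gammaℝ s)⁻¹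

/-- The factor `(s - 1) γ(1 - s) / γ(s)` of the functional equation of an odd primitive
character. -/
noncomputable def oddFactor (s : ℂ) : ℂ := (s - 1) * Gammaℝ (2 - s) * (Gammaℝ (s + 1))⁻¹

lemma evenFactor_eq {s : ℂ} (hs : s ≠ 1) :
    evenFactor s = (s - 1) * Gammaℝ (1 - s) * (Gammaℝ s)⁻¹ := by
  have h := Gammaℝ_add_two (s := 1 - s) (sub_ne_zero.2 hs.symm)
  rw [show 1 - s + 2 = 3 - s by ring] at h
  rw [evenFactor, h]
  have : (π : ℂ) ≠ 0 := ofReal_ne_zero.2 Real.pi_ne_zero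
  field_simp
  ring

lemma differentiableAt_evenFactor {s : ℂ} (h : s.re < 3) : DifferentiableAt ℂ evenFactor s := by
  have h1 := differentiableAt_Gammaℝ_sub (b := 3) h
  exact ((by simpa using h1 : DifferentiableAt ℂ (fun s ↦ Gammaℝ (3 - s)) s).const_mul _).mul
    (differentiable_Gammaℝ_inv s)

lemma differentiableAt_oddFactor {s : ℂ} (h : s.re < 2) : DifferentiableAt ℂ oddFactor s := by
  have h1 := differentiableAt_Gammaℝ_sub (b := 2) h
  refine .mul (.mul (by fun_prop)
    (by simpa using h1 : DifferentiableAt ℂ (fun s ↦ Gammaℝ (2 - s)) s)) ?_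
  exact (differentiable_Gammaℝ_inv (s + 1)).comp s (f := fun s ↦ s + 1) (by fun_prop)

lemma stripExpBounded_evenFactor : StripExpBounded evenFactor := by
  refine .mul (.mul (.const _) ?_) stripExpBounded_inv_Gammaℝ
  simpa using stripExpBounded_Gammaℝ_sub (b := 3) (by norm_num)

lemma stripExpBounded_oddFactor : StripExpBounded oddFactor := by
  refine .mul (.mul (.sub .id (.const 1)) ?_) stripExpBounded_inv_Gammaℝ_add_one
  simpa using stripExpBounded_Gammaℝ_sub (b := 2) (by norm_num)

lemma norm_add_mul_I_le (a t : ℝ) (ha : |a| ≤ 2) : ‖(a : ℂ) + t * I‖ ≤ 2 * (1 + |t|) := by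
  refine (norm_add_le _ _).trans ?_
  simp only [norm_mul, norm_real, norm_I, Real.norm_eq_abs]
  linarith [abs_nonneg t]

lemma norm_evenFactor_half (t : ℝ) : ‖evenFactor (1 / 2 + t * I)‖ = ‖(1 / 2 : ℂ) + t * I‖ := by
  rw [evenFactor_eq (by intro h; simpa using congrArg Complex.re h), norm_mul, norm_mul,
    norm_Gammaℝ_eq_of_conj (s := 1 / 2 + t * I) (by simp [Complex.ext_iff, map_ofNat]; norm_num),
    norm_inv,
    mul_inv_cancel_right₀]
  · rw [← RCLike.norm_conj, ← norm_neg]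
    congr 1
    simp [Complex.ext_iff]; norm_num
  · exact norm_ne_zero_iff.2 (Gammaℝ_ne_zero_of_re_pos (by simp))

lemma norm_oddFactor_half (t : ℝ) : ‖oddFactor (1 / 2 + t * I)‖ = ‖(1 / 2 : ℂ) + t * I‖ := by
  rw [oddFactor, norm_mul, norm_mul,
    norm_Gammaℝ_eq_of_conj (s := 1 / 2 + t * I + 1) (by simp [Complex.ext_iff, map_ofNat]; norm_num),
    norm_inv,
    mul_inv_cancel_right₀]
  · rw [← RCLike.norm_conj, ← norm_neg]
    congr 1
    simp [Complex.ext_iff]; norm_num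
  · exact norm_ne_zero_iff.2 (Gammaℝ_ne_zero_of_re_pos (by simp; norm_num))

lemma norm_evenFactor_three_halves (t : ℝ) : ‖evenFactor (3 / 2 + t * I)‖ = 2 * π := by
  rw [evenFactor, norm_mul, norm_mul,
    norm_Gammaℝ_eq_of_conj (s := 3 / 2 + t * I) (by simp [Complex.ext_iff, map_ofNat]; norm_num),
    norm_inv,
    mul_inv_cancel_right₀]
  · simp [abs_of_pos Real.pi_pos]
  · exact norm_ne_zero_iff.2 (Gammaℝ_ne_zero_of_re_pos (by simp))

lemma norm_oddFactor_three_halves (t : ℝ) : ‖oddFactor (3 / 2 + t * I)‖ = 2 * π := by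
  have hne : (1 / 2 : ℂ) + t * I ≠ 0 := by intro h; simpa using congrArg Complex.re h
  have h : Gammaℝ (3 / 2 + t * I + 1) = Gammaℝ (1 / 2 + t * I) * (1 / 2 + t * I) / 2 / π := by
    rw [← Gammaℝ_add_two hne]
    congr 1; ring
  rw [oddFactor, h, norm_mul, norm_mul,
    norm_Gammaℝ_eq_of_conj (s := 1 / 2 + t * I) (by simp [Complex.ext_iff, map_ofNat]; norm_num),
    norm_inv,
    norm_div, norm_div, norm_mul, show (3 / 2 + t * I - 1 : ℂ) = 1 / 2 + t * I by ring]
  have h1 : ‖Gammaℝ (1 / 2 + t * I)‖ ≠ 0 :=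
    norm_ne_zero_iff.2 (Gammaℝ_ne_zero_of_re_pos (by simp))
  have h2 := norm_ne_zero_iff.2 hne
  simp only [Complex.norm_ofNat, norm_real, Real.norm_of_nonneg Real.pi_pos.le]
  generalize ‖Gammaℝ (1 / 2 + t * I)‖ = x at *
  generalize ‖(1 / 2 : ℂ) + t * I‖ = y at *
  have := Real.pi_ne_zero
  field_simp

lemma norm_evenFactor_neg_half_le (t : ℝ) :
    ‖evenFactor (-1 / 2 + t * I)‖ ≤ 4 * (1 + |t|) ^ 2 := by
  have h1 : ((-1 / 2 : ℝ) : ℂ) + t * I ≠ 0 := by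
    intro h; simpa using congrArg Complex.re h
  have h2 : ((3 / 2 : ℝ) : ℂ) + t * I ≠ 0 := by
    intro h; simpa using congrArg Complex.re h
  have h3 := Gammaℝ_add_two h1
  rw [show ((-1 / 2 : ℝ) : ℂ) + t * I + 2 = ((3 / 2 : ℝ) : ℂ) + t * I by push_cast; ring] at h3
  have h4 := Gammaℝ_add_two h2
  rw [h3] at h4
  have hG : Gammaℝ (((-1 / 2 : ℝ) : ℂ) + t * I) ≠ 0 := by
    intro h
    rw [h, zero_mul, zero_div, zero_div] at h3
    exact Gammaℝ_ne_zero_of_re_pos (by simp) h3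
  have hG' := norm_ne_zero_iff.2 hG
  rw [show (-1 / 2 + t * I : ℂ) = ((-1 / 2 : ℝ) : ℂ) + t * I by push_cast; ring,
    evenFactor, norm_mul, norm_mul,
    norm_Gammaℝ_eq_of_conj (s := ((3 / 2 : ℝ) : ℂ) + t * I + 2)
      (by simp [Complex.ext_iff, map_ofNat]; norm_num), h4]
  simp only [norm_mul, norm_div, norm_inv, norm_neg, Complex.norm_ofNat, norm_real,
    Real.norm_of_nonneg Real.pi_pos.le]
  have e : ∀ g x y : ℝ, g ≠ 0 →
      2 * π * (g * x / 2 / π * y / 2 / π) * g⁻¹ = x * y / (2 * π) := by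
    intro g x y hg
    have := Real.pi_ne_zero
    field_simp
  rw [e _ _ _ hG']
  have h5 := norm_add_mul_I_le (-1 / 2) t (by rw [abs_le]; norm_num)
  have h6 := norm_add_mul_I_le (3 / 2) t (by rw [abs_le]; norm_num)
  refine (div_le_self (by positivity) (by linarith [Real.pi_gt_three])).trans ?_
  calc _ ≤ (2 * (1 + |t|)) * (2 * (1 + |t|)) := by gcongr
    _ = _ := by ring

lemma norm_oddFactor_neg_half_le (t : ℝ) :
    ‖oddFactor (-1 / 2 + t * I)‖ ≤ 4 * (1 + |t|) ^ 2 := by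
  have h1 : ((1 / 2 : ℝ) : ℂ) + t * I ≠ 0 := by
    intro h; simpa using congrArg Complex.re h
  have h3 := Gammaℝ_add_two h1
  have hG : Gammaℝ (((1 / 2 : ℝ) : ℂ) + t * I) ≠ 0 :=
    Gammaℝ_ne_zero_of_re_pos (by simp)
  have hG' := norm_ne_zero_iff.2 hG
  rw [oddFactor, norm_mul, norm_mul,
    norm_Gammaℝ_eq_of_conj (s := ((1 / 2 : ℝ) : ℂ) + t * I + 2)
      (by simp [Complex.ext_iff, map_ofNat]; norm_num), h3,
    show (-1 / 2 + t * I - 1 : ℂ) = ((-3 / 2 : ℝ) : ℂ) + t * I by push_cast; ring,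
    show (-1 / 2 + t * I + 1 : ℂ) = ((1 / 2 : ℝ) : ℂ) + t * I by push_cast; ring]
  simp only [norm_mul, norm_div, norm_inv, Complex.norm_ofNat, norm_real,
    Real.norm_of_nonneg Real.pi_pos.le]
  have e : ∀ g x y : ℝ, g ≠ 0 →
      x * (g * y / 2 / π) * g⁻¹ = x * y / (2 * π) := by
    intro g x y hg
    have := Real.pi_ne_zero
    field_simp
  rw [e _ _ _ hG']
  have h5 := norm_add_mul_I_le (-3 / 2) t (by rw [abs_le]; norm_num)
  have h6 := norm_add_mul_I_le (1 / 2) t (by rw [abs_le]; norm_num)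
  refine (div_le_self (by positivity) (by linarith [Real.pi_gt_three])).trans ?_
  calc _ ≤ (2 * (1 + |t|)) * (2 * (1 + |t|)) := by gcongr
    _ = _ := by ring

/-- `E` is the entire function `(s - 1) L(s, χ)` and `Y` is `s - 1` times the factor in the
asymmetric functional equation of `L(s, χ)`, together with the growth bounds on the lines
`Re s = -1/2, 1/2, 3/2`. -/
structure IsFunctionalEquationPair {N : ℕ} [NeZero N] (χ : DirichletCharacter ℂ N)
    (E Y : ℂ → ℂ) (C : ℝ) : Prop where
  nonneg : 0 ≤ C
  differentiable : Differentiable ℂ E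
  eq_LFunction : ∀ s ≠ 1, E s = (s - 1) * χ.LFunction s
  stripExpBounded : StripExpBounded E
  differentiableAt_factor : ∀ s : ℂ, s.re < 2 → DifferentiableAt ℂ Y s
  stripExpBounded_factor : StripExpBounded Y
  norm_factor_half : ∀ t : ℝ, ‖Y (1 / 2 + t * I)‖ ≤ C * (1 + |t|)
  norm_factor_three_halves : ∀ t : ℝ, ‖Y (3 / 2 + t * I)‖ ≤ C
  norm_factor_neg_half : ∀ t : ℝ, ‖Y (-1 / 2 + t * I)‖ ≤ C * (1 + |t|) ^ 2
  eq_factor_mul : ∀ t : ℝ, E (-1 / 2 + t * I) =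
    Y (-1 / 2 + t * I) * starRingEnd ℂ (χ.LFunction (3 / 2 + t * I))

lemma conj_natCast_cpow (n : ℕ) (z : ℂ) :
    starRingEnd ℂ ((n : ℂ) ^ z) = (n : ℂ) ^ (starRingEnd ℂ z) := by
  have h : (n : ℂ).arg ≠ π := by rw [natCast_arg]; exact Real.pi_ne_zero.symm
  rw [cpow_conj _ _ h, Complex.conj_natCast]

lemma conj_LFunction_three_halves {N : ℕ} [NeZero N] (χ : DirichletCharacter ℂ N) (t : ℝ) :
    χ⁻¹.LFunction (3 / 2 - t * I) = starRingEnd ℂ (χ.LFunction (3 / 2 + t * I)) := by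
  rw [DirichletCharacter.LFunction_eq_LSeries _ (by simp; norm_num),
    DirichletCharacter.LFunction_eq_LSeries _ (by simp; norm_num), LSeries, LSeries,
    Complex.conj_tsum]
  refine tsum_congr fun n ↦ ?_
  rcases eq_or_ne n 0 with rfl | hn
  · simp
  rw [LSeries.term_of_ne_zero hn, LSeries.term_of_ne_zero hn, map_div₀, ← MulChar.star_apply']
  congr 1
  rw [conj_natCast_cpow]
  simp [map_ofNat, sub_eq_add_neg]

lemma exists_isFunctionalEquationPair {N : ℕ} [NeZero N] {χ : DirichletCharacter ℂ N}
    (hχ : χ.IsPrimitive) : ∃ E Y C, IsFunctionalEquationPair χ E Y C := by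
  obtain ⟨E, hE, hEL, hEb⟩ := exists_entire_sub_one_mul_LFunction χ
  obtain ⟨F, hFd, hFb, hF1, hF2, hF3, hFe⟩ : ∃ F : ℂ → ℂ,
      (∀ s : ℂ, s.re < 2 → DifferentiableAt ℂ F s) ∧ StripExpBounded F ∧
      (∀ t : ℝ, ‖F (1 / 2 + t * I)‖ = ‖(1 / 2 : ℂ) + t * I‖) ∧
      (∀ t : ℝ, ‖F (3 / 2 + t * I)‖ = 2 * π) ∧
      (∀ t : ℝ, ‖F (-1 / 2 + t * I)‖ ≤ 4 * (1 + |t|) ^ 2) ∧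
      (∀ s ≠ 1, F s = (s - 1) * χ⁻¹.gammaFactor (1 - s) * (χ.gammaFactor s)⁻¹) := by
    rcases χ.even_or_odd with h | h
    · have h' : χ⁻¹.Even := by
        rw [DirichletCharacter.Even, MulChar.inv_apply_eq_inv', h, inv_one]
      exact ⟨evenFactor, fun s hs ↦ differentiableAt_evenFactor (by linarith),
        stripExpBounded_evenFactor, norm_evenFactor_half, norm_evenFactor_three_halves,
        norm_evenFactor_neg_half_le, fun s hs ↦ by
          rw [evenFactor_eq hs, h.gammaFactor_def, h'.gammaFactor_def]⟩
    · have h' : χ⁻¹.Odd := by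
        rw [DirichletCharacter.Odd, MulChar.inv_apply_eq_inv', h]; norm_num
      exact ⟨oddFactor, fun s hs ↦ differentiableAt_oddFactor hs,
        stripExpBounded_oddFactor, norm_oddFactor_half, norm_oddFactor_three_halves,
        norm_oddFactor_neg_half_le, fun s hs ↦ by
          rw [oddFactor, h.gammaFactor_def, h'.gammaFactor_def]; ring_nf⟩
  have hN : 0 < (N : ℝ) := by exact_mod_cast NeZero.pos N
  have hN1 : 1 ≤ (N : ℝ) := by exact_mod_cast NeZero.pos N
  have hNc : (N : ℂ) ≠ 0 := NeZero.ne _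
  have hnorm : ∀ z : ℂ, ‖(N : ℂ) ^ z‖ = (N : ℝ) ^ z.re := fun z ↦ by
    rw [← ofReal_natCast, norm_cpow_eq_rpow_re_of_pos hN]
  set ε := DirichletCharacter.rootNumber χ
  have hpi := Real.pi_gt_three
  have hpi4 := Real.pi_le_four
  refine ⟨E, fun s ↦ ε * (N : ℂ) ^ (1 / 2 - s) * F s, ‖ε‖ * N * 8, by positivity, hE, hEL, hEb,
    fun s hs ↦ ?_, ?_, fun t ↦ ?_, fun t ↦ ?_, fun t ↦ ?_, fun t ↦ ?_⟩
  · refine .mul ?_ (hFd s hs)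
    exact (((differentiableAt_const _).sub differentiableAt_id).const_cpow (.inl hNc)).const_mul _
  · refine .mul (.mul (.const _) ?_) hFb
    simpa [sub_eq_add_neg] using StripExpBounded.const_cpow hN (1 / 2) (-1)
  · have := norm_add_mul_I_le (1 / 2) t (by rw [abs_le]; norm_num)
    push_cast at this
    rw [norm_mul, norm_mul, hF1, hnorm]
    simp only [one_div, sub_add_cancel_left, neg_re, mul_re, ofReal_re, I_re, mul_zero, ofReal_im,
      I_im, mul_one, sub_self, neg_zero, Real.rpow_zero] at this ⊢
    calc _ ≤ ‖ε‖ * (2 * (1 + |t|)) := by gcongr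
      _ ≤ ‖ε‖ * (N * 8 * (1 + |t|)) := by gcongr; nlinarith
      _ = _ := by ring
  · rw [norm_mul, norm_mul, hF2, hnorm]
    have : (1 / 2 - (3 / 2 + t * I) : ℂ).re = -1 := by simp; norm_num
    rw [this, Real.rpow_neg_one]
    have : (N : ℝ)⁻¹ ≤ N := (inv_le_one_of_one_le₀ hN1).trans hN1
    gcongr; linarith
  · rw [norm_mul, norm_mul, hnorm]
    have : (1 / 2 - (-1 / 2 + t * I) : ℂ).re = 1 := by simp; norm_num
    rw [this, Real.rpow_one]
    calc _ ≤ ‖ε‖ * N * (4 * (1 + |t|) ^ 2) := by gcongr; exact hF3 t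
      _ ≤ ‖ε‖ * N * (8 * (1 + |t|) ^ 2) := by gcongr; norm_num
      _ = _ := by ring
  · have h1 : (-1 / 2 + t * I : ℂ) ≠ 1 := by
      intro h; have := congrArg Complex.re h; norm_num at this
    have h0 : (-1 / 2 + t * I : ℂ) ≠ 0 := by
      intro h; have := congrArg Complex.re h; norm_num at this
    have h2 : (3 / 2 - t * I : ℂ) ≠ 0 := by
      intro h; have := congrArg Complex.re h; norm_num at this
    have hγ : χ⁻¹.gammaFactor (3 / 2 - t * I) ≠ 0 := by
      rcases χ⁻¹.even_or_odd with h | h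
      · rw [h.gammaFactor_def]; exact Gammaℝ_ne_zero_of_re_pos (by simp)
      · rw [h.gammaFactor_def]; exact Gammaℝ_ne_zero_of_re_pos (by simp; norm_num)
    have key := hχ.completedLFunction_one_sub (3 / 2 - t * I)
    rw [show (1 - (3 / 2 - t * I) : ℂ) = -1 / 2 + t * I by ring] at key
    rw [hEL _ h1, hFe _ h1, ← conj_LFunction_three_halves,
      DirichletCharacter.LFunction_eq_completed_div_gammaFactor χ _ (.inl h0),
      DirichletCharacter.LFunction_eq_completed_div_gammaFactor χ⁻¹ _ (.inl h2), key,
      show (1 - (-1 / 2 + t * I) : ℂ) = 3 / 2 - t * I by ring,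
      show (1 / 2 - (-1 / 2 + t * I) : ℂ) = 3 / 2 - t * I - 1 / 2 by ring]
    generalize χ⁻¹.gammaFactor (3 / 2 - t * I) = g at *
    change _ = DirichletCharacter.rootNumber χ * _ * _ * _
    field_simp

/-- Factoring out the greatest common divisor of a pair of positive integers. -/
noncomputable def mulCoprimeEquiv :
    ℕ+ × {p : ℕ+ × ℕ+ // Nat.Coprime p.1 p.2} ≃ ℕ+ × ℕ+ :=
  Equiv.ofBijective (fun x ↦ (x.1 * x.2.1.1, x.1 * x.2.1.2)) <| by
    constructor
    · rintro ⟨g, ⟨⟨v, w⟩, h⟩⟩ ⟨g', ⟨⟨v', w'⟩, h'⟩⟩ heq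
      simp only [Prod.mk.injEq] at heq h h'
      obtain ⟨h1, h2⟩ := heq
      obtain rfl : g = g' := by
        have e := congrArg₂ (fun a b : ℕ+ ↦ Nat.gcd a b) h1 h2
        simp only [PNat.mul_coe, Nat.gcd_mul_left, h.gcd_eq_one, h'.gcd_eq_one, mul_one] at e
        exact PNat.eq e
      obtain rfl := mul_left_cancel h1
      obtain rfl := mul_left_cancel h2
      rfl
    · rintro ⟨a, b⟩
      obtain ⟨v, w, h, hv, hw⟩ := Nat.exists_coprime (a : ℕ) b
      have hg : 0 < Nat.gcd a b := Nat.gcd_pos_of_pos_left _ a.pos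
      have hv0 : 0 < v := Nat.pos_of_ne_zero (by rintro rfl; simp at hv)
      have hw0 : 0 < w := Nat.pos_of_ne_zero (by rintro rfl; simp at hw)
      generalize Nat.gcd a b = g at hv hw hg
      lift g to ℕ+ using hg
      lift v to ℕ+ using hv0
      lift w to ℕ+ using hw0
      refine ⟨⟨g, ⟨⟨v, w⟩, h⟩⟩, Prod.ext (PNat.eq ?_) (PNat.eq ?_)⟩
      · simpa [mul_comm] using hv.symm
      · simpa [mul_comm] using hw.symm

lemma mulCoprimeEquiv_apply (x : ℕ+ × {p : ℕ+ × ℕ+ // Nat.Coprime p.1 p.2}) :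
    mulCoprimeEquiv x = (x.1 * x.2.1.1, x.1 * x.2.1.2) := rfl

/-- Pairs of factorisations `d₁ e₁ = d₂ e₂` of the same positive integer are parametrised by
`d₁ = u v`, `e₁ = w z`, `d₂ = u w`, `e₂ = v z` with `v` and `w` coprime. -/
noncomputable def factorisationPairEquiv :
    (ℕ+ × ℕ+) × {p : ℕ+ × ℕ+ // Nat.Coprime p.1 p.2} ≃
      Σ n : ℕ+, (n : ℕ).divisorsAntidiagonal × (n : ℕ).divisorsAntidiagonal :=
  Equiv.ofBijective (fun x ↦ ⟨x.1.1 * x.2.1.1 * x.2.1.2 * x.1.2,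
      ⟨((x.1.1 * x.2.1.1 : ℕ+), (x.2.1.2 * x.1.2 : ℕ+)), by
        simp [Nat.mem_divisorsAntidiagonal, mul_assoc]⟩,
      ⟨((x.1.1 * x.2.1.2 : ℕ+), (x.2.1.1 * x.1.2 : ℕ+)), by
        simp [Nat.mem_divisorsAntidiagonal]; ring⟩⟩) <| by
    constructor
    · rintro ⟨⟨u, z⟩, ⟨⟨v, w⟩, h⟩⟩ ⟨⟨u', z'⟩, ⟨⟨v', w'⟩, h'⟩⟩ heq
      have h1 := congrArg (fun x ↦ (x.2.1 : ℕ × ℕ).1) heq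
      have h2 := congrArg (fun x ↦ (x.2.2 : ℕ × ℕ).1) heq
      have h3 := congrArg (fun x ↦ (x.2.1 : ℕ × ℕ).2) heq
      dsimp only at h1 h2 h3 h h'
      obtain rfl : u = u' := by
        have e := congrArg₂ Nat.gcd h1 h2
        simp only [PNat.mul_coe, Nat.gcd_mul_left, h.gcd_eq_one, h'.gcd_eq_one, mul_one] at e
        exact PNat.eq e
      obtain rfl := mul_left_cancel (PNat.eq h1)
      obtain rfl := mul_left_cancel (PNat.eq h2)
      obtain rfl := mul_left_cancel (PNat.eq h3)
      rfl
    · rintro ⟨n, ⟨⟨⟨a, b⟩, hab⟩, ⟨⟨c, d⟩, hcd⟩⟩⟩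
      have hab' := (Nat.mem_divisorsAntidiagonal.1 hab).1
      have hcd' := (Nat.mem_divisorsAntidiagonal.1 hcd).1
      have hn := n.pos
      dsimp only at hab' hcd'
      have ha : 0 < a := Nat.pos_of_ne_zero (by rintro rfl; simp at hab'; omega)
      have hb : 0 < b := Nat.pos_of_ne_zero (by rintro rfl; simp at hab'; omega)
      have hc : 0 < c := Nat.pos_of_ne_zero (by rintro rfl; simp at hcd'; omega)
      have hd : 0 < d := Nat.pos_of_ne_zero (by rintro rfl; simp at hcd'; omega)
      obtain ⟨v, w, h, hv, hw⟩ := Nat.exists_coprime a c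
      have hu : 0 < Nat.gcd a c := Nat.gcd_pos_of_pos_left _ ha
      generalize Nat.gcd a c = u at hv hw hu
      subst hv hw
      have hvw : v * b = w * d := by
        have := hab'.trans hcd'.symm
        refine Nat.eq_of_mul_eq_mul_left hu ?_
        linarith
      obtain ⟨z, rfl⟩ : w ∣ b := h.symm.dvd_of_dvd_mul_left ⟨d, hvw⟩
      have hw0 : 0 < w := Nat.pos_of_mul_pos_right hc
      have hv0 : 0 < v := Nat.pos_of_mul_pos_right ha
      have hz0 : 0 < z := Nat.pos_of_mul_pos_left hb
      obtain rfl : d = v * z := by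
        refine Nat.eq_of_mul_eq_mul_left hw0 ?_
        linarith
      lift u to ℕ+ using hu
      lift v to ℕ+ using hv0
      lift w to ℕ+ using hw0
      lift z to ℕ+ using hz0
      obtain rfl : n = u * v * w * z := by
        apply PNat.eq; rw [← hab']; push_cast; ring
      exact ⟨⟨⟨u, z⟩, ⟨⟨v, w⟩, h⟩⟩, by simp [mul_comm]⟩

lemma factorisationPairEquiv_apply_fst
    (x : (ℕ+ × ℕ+) × {p : ℕ+ × ℕ+ // Nat.Coprime p.1 p.2}) :
    ((factorisationPairEquiv x).2.1 : ℕ × ℕ) =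
      ((x.1.1 : ℕ) * (x.2.1.1 : ℕ), (x.2.1.2 : ℕ) * (x.1.2 : ℕ)) := rfl

lemma factorisationPairEquiv_apply_snd
    (x : (ℕ+ × ℕ+) × {p : ℕ+ × ℕ+ // Nat.Coprime p.1 p.2}) :
    ((factorisationPairEquiv x).2.2 : ℕ × ℕ) =
      ((x.1.1 : ℕ) * (x.2.1.2 : ℕ), (x.2.1.1 : ℕ) * (x.1.2 : ℕ)) := rfl

lemma tsum_norm_sq_convolution_le (α β : ℕ →* ℂ) (hα : Summable fun n : ℕ+ ↦ ‖α n‖ ^ 2)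
    (hβ : Summable fun n : ℕ+ ↦ ‖β n‖ ^ 2) :
    Summable (fun n : ℕ+ ↦ ‖∑ x ∈ (n : ℕ).divisorsAntidiagonal, α x.1 * β x.2‖ ^ 2) ∧
    ∑' n : ℕ+, ‖∑ x ∈ (n : ℕ).divisorsAntidiagonal, α x.1 * β x.2‖ ^ 2 ≤
      (∑' n : ℕ+, ‖α n‖ ^ 2) * (∑' n : ℕ+, ‖β n‖ ^ 2) *
        ‖∑' n : ℕ+, α n * starRingEnd ℂ (β n)‖ ^ 2 := by
  set γ : ℕ+ → ℂ := fun n ↦ α n * starRingEnd ℂ (β n) with hγ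
  set κ : {p : ℕ+ × ℕ+ // Nat.Coprime p.1 p.2} → ℂ :=
    fun p ↦ γ p.1.1 * starRingEnd ℂ (γ p.1.2) with hκ
  have hγs : Summable fun n ↦ ‖γ n‖ := by
    refine .of_nonneg_of_le (fun _ ↦ norm_nonneg _) (fun n ↦ ?_) (hα.add hβ)
    simp only [hγ, norm_mul, RCLike.norm_conj]
    nlinarith [sq_nonneg (‖α n‖ - ‖β n‖), sq_nonneg ‖α n‖, sq_nonneg ‖β n‖]
  have hγ2 : Summable fun n ↦ ‖γ n‖ ^ 2 := by
    refine .of_nonneg_of_le (fun _ ↦ sq_nonneg _) (fun n ↦ ?_) (hγs.mul_left (∑' n, ‖γ n‖))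
    rw [sq]
    gcongr
    exact hγs.le_tsum n fun _ _ ↦ norm_nonneg _
  have hγc : Summable fun n ↦ ‖starRingEnd ℂ (γ n)‖ := by simpa using hγs
  have hpair : Summable fun p : ℕ+ × ℕ+ ↦ ‖γ p.1 * starRingEnd ℂ (γ p.2)‖ := by
    simpa using hγs.mul_of_nonneg hγc (fun _ ↦ norm_nonneg _) (fun _ ↦ norm_nonneg _)
  have hκs : Summable fun p ↦ ‖κ p‖ := hpair.comp_injective Subtype.val_injective
  have hγ1 : ‖γ 1‖ ^ 2 = 1 := by simp [hγ]
  have hγmul : ∀ m n, γ (m * n) = γ m * γ n := fun m n ↦ by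
    simp only [hγ, PNat.mul_coe, map_mul]; ring
  have hsum1 : (1 : ℝ) ≤ ∑' n, ‖γ n‖ ^ 2 := hγ1 ▸ hγ2.le_tsum 1 fun _ _ ↦ sq_nonneg _
  have hconj : ∀ z : ℂ, z * starRingEnd ℂ z = ((‖z‖ ^ 2 : ℝ) : ℂ) := fun z ↦ by
    rw [Complex.mul_conj, Complex.normSq_eq_norm_sq]
  have hK : ((‖∑' n, γ n‖ ^ 2 : ℝ) : ℂ) = ((∑' n, ‖γ n‖ ^ 2 : ℝ) : ℂ) * ∑' p, κ p := by
    rw [← hconj, Complex.conj_tsum, tsum_mul_tsum_of_summable_norm hγs hγc,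
      ← mulCoprimeEquiv.tsum_eq, Complex.ofReal_tsum, tsum_mul_tsum_of_summable_norm _ hκs]
    · refine tsum_congr fun x ↦ ?_
      simp only [mulCoprimeEquiv_apply, hγmul, map_mul, hκ, ← hconj]
      ring
    · simpa using hγ2
  have hA : Summable fun n : ℕ+ ↦ ‖((‖α n‖ ^ 2 : ℝ) : ℂ)‖ := by simpa using hα
  have hB : Summable fun n : ℕ+ ↦ ‖((‖β n‖ ^ 2 : ℝ) : ℂ)‖ := by simpa using hβ
  have hAB : Summable fun p : ℕ+ × ℕ+ ↦
      ‖((‖α p.1‖ ^ 2 : ℝ) : ℂ) * ((‖β p.2‖ ^ 2 : ℝ) : ℂ)‖ := by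
    simpa using hA.mul_of_nonneg hB (fun _ ↦ norm_nonneg _) (fun _ ↦ norm_nonneg _)
  set h : ℕ × ℕ → ℂ := fun x ↦ α x.1 * β x.2 with hh
  have hall : HasSum (fun x : (ℕ+ × ℕ+) × {p : ℕ+ × ℕ+ // Nat.Coprime p.1 p.2} ↦
      ((‖α x.1.1‖ ^ 2 : ℝ) : ℂ) * ((‖β x.1.2‖ ^ 2 : ℝ) : ℂ) * κ x.2)
      (((∑' n : ℕ+, ‖α n‖ ^ 2) * (∑' n : ℕ+, ‖β n‖ ^ 2) : ℝ) * ∑' p, κ p) := by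
    rw [Complex.ofReal_mul, Complex.ofReal_tsum, Complex.ofReal_tsum,
      tsum_mul_tsum_of_summable_norm hA hB, tsum_mul_tsum_of_summable_norm hAB hκs]
    refine Summable.hasSum (.of_norm ?_)
    simpa using hAB.mul_of_nonneg hκs (fun _ ↦ norm_nonneg _) (fun _ ↦ norm_nonneg _)
  have hall' : HasSum (fun y : Σ n : ℕ+,
      (n : ℕ).divisorsAntidiagonal × (n : ℕ).divisorsAntidiagonal ↦
        h y.2.1 * starRingEnd ℂ (h y.2.2))
      (((∑' n : ℕ+, ‖α n‖ ^ 2) * (∑' n : ℕ+, ‖β n‖ ^ 2) : ℝ) * ∑' p, κ p) := by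
    rw [← factorisationPairEquiv.hasSum_iff]
    refine hall.congr_fun fun x ↦ ?_
    simp only [Function.comp, factorisationPairEquiv_apply_fst, factorisationPairEquiv_apply_snd,
      hh, hκ, hγ, map_mul, ← hconj, Complex.conj_conj]
    ring
  have hn := hall'.sigma (g := fun n : ℕ+ ↦
      ((‖∑ x ∈ (n : ℕ).divisorsAntidiagonal, α x.1 * β x.2‖ ^ 2 : ℝ) : ℂ)) fun n ↦ by
    have := hasSum_fintype fun y : (n : ℕ).divisorsAntidiagonal × (n : ℕ).divisorsAntidiagonal ↦
      h y.1 * starRingEnd ℂ (h y.2)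
    convert this using 1
    rw [Fintype.sum_prod_type, ← hconj, map_sum, Finset.sum_mul_sum,
      ← Finset.sum_coe_sort (n : ℕ).divisorsAntidiagonal]
    refine Finset.sum_congr rfl fun x _ ↦ ?_
    rw [← Finset.sum_coe_sort (n : ℕ).divisorsAntidiagonal]
  have hκR : ∑' p, κ p = ((‖∑' n, γ n‖ ^ 2 / (∑' n, ‖γ n‖ ^ 2) : ℝ) : ℂ) := by
    have : ((∑' n, ‖γ n‖ ^ 2 : ℝ) : ℂ) ≠ 0 := by
      rw [Complex.ofReal_ne_zero]; linarith
    rw [Complex.ofReal_div, hK, mul_div_cancel_left₀ _ this]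
  rw [hκR, ← Complex.ofReal_mul, Complex.hasSum_ofReal] at hn
  refine ⟨hn.summable, hn.tsum_eq.trans_le ?_⟩
  refine mul_le_mul_of_nonneg_left (div_le_self (sq_nonneg _) hsum1) ?_
  exact mul_nonneg (tsum_nonneg fun _ ↦ by positivity) (tsum_nonneg fun _ ↦ by positivity)

lemma hasSum_pnat_iff_of_map_zero {α : Type*} [AddCommMonoid α] [TopologicalSpace α]
    {f : ℕ → α} (h0 : f 0 = 0)
    {a : α} : HasSum (fun n : ℕ+ ↦ f n) a ↔ HasSum f a := by
  refine PNat.coe_injective.hasSum_iff fun n hn ↦ ?_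
  rcases Nat.eq_zero_or_pos n with rfl | h
  · exact h0
  · exact absurd ⟨⟨n, h⟩, rfl⟩ hn

lemma exists_tsum_one_div_rpow_le : ∃ B : ℝ, ∀ η : ℝ, 0 < η → η ≤ 1 →
    ∑' n : ℕ, 1 / (n : ℝ) ^ (1 + η) ≤ B / η := by
  obtain ⟨E, hE, hEL, -⟩ := exists_entire_sub_one_mul_LFunction (1 : DirichletCharacter ℂ 1)
  obtain ⟨B, hB⟩ := (isCompact_Icc (a := (0 : ℝ)) (b := 1)).exists_bound_of_continuousOn
    (f := fun η : ℝ ↦ E (1 + η)) (hE.continuous.comp (by fun_prop)).continuousOn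
  refine ⟨B, fun η h0 h1 ↦ ?_⟩
  have hη : (1 + η : ℂ) ≠ 1 := by simpa using h0.ne'
  have h := hB η ⟨h0.le, h1⟩
  rw [hEL _ hη, DirichletCharacter.LFunction_modOne_eq,
    zeta_eq_tsum_one_div_nat_cpow (by simpa using h0)] at h
  have e : ∑' n : ℕ, 1 / (n : ℂ) ^ (1 + η : ℂ) = ((∑' n : ℕ, 1 / (n : ℝ) ^ (1 + η) : ℝ) : ℂ) := by
    rw [ofReal_tsum]
    refine tsum_congr fun n ↦ ?_
    rw [ofReal_div, ofReal_cpow n.cast_nonneg]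
    simp
  rw [e, add_sub_cancel_left, norm_mul, norm_real, norm_real, Real.norm_of_nonneg h0.le,
    Real.norm_of_nonneg (tsum_nonneg fun n ↦ by positivity)] at h
  rw [le_div_iff₀ h0]
  linarith

/-- The completely multiplicative function `n ↦ χ(n) n ^ (-σ)`. -/
noncomputable def twistHom {M : ℕ} (χ : DirichletCharacter ℂ M) (σ : ℝ) : ℕ →* ℂ where
  toFun n := χ n * (((n : ℝ) ^ (-σ) : ℝ) : ℂ)
  map_one' := by simp
  map_mul' m n := by
    rw [Nat.cast_mul, Nat.cast_mul, map_mul, Real.mul_rpow m.cast_nonneg n.cast_nonneg]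
    push_cast
    ring

lemma twistHom_apply {M : ℕ} (χ : DirichletCharacter ℂ M) (σ : ℝ) (n : ℕ) :
    twistHom χ σ n = χ n * (((n : ℝ) ^ (-σ) : ℝ) : ℂ) := rfl

lemma norm_twistHom_sq_le {M : ℕ} (χ : DirichletCharacter ℂ M) (σ : ℝ) (n : ℕ) :
    ‖twistHom χ (σ / 2) n‖ ^ 2 ≤ 1 / (n : ℝ) ^ σ := by
  rw [twistHom_apply, norm_mul, mul_pow, norm_real, Real.norm_of_nonneg (by positivity),
    ← Real.rpow_natCast, ← Real.rpow_natCast, ← Real.rpow_mul n.cast_nonneg, one_div,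
    ← Real.rpow_neg n.cast_nonneg]
  have h1 : ‖χ n‖ ^ ((2 : ℕ) : ℝ) ≤ 1 :=
    Real.rpow_le_one (norm_nonneg _) (χ.norm_le_one _) (by simp)
  rw [show -(σ / 2) * ((2 : ℕ) : ℝ) = -σ by push_cast; ring]
  exact mul_le_of_le_one_left (by positivity) h1

lemma changeLevel_mul_inv_apply {M N : ℕ} (χ : DirichletCharacter ℂ M) (ν : DirichletCharacter ℂ N)
    (n : ℕ) : (χ.changeLevel (M.dvd_mul_right N) * (ν.changeLevel (N.dvd_mul_left M))⁻¹) n =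
      χ n * starRingEnd ℂ (ν n) := by
  rw [MulChar.mul_apply, ← MulChar.star_eq_inv, MulChar.star_apply, RCLike.star_def]
  by_cases h : Nat.Coprime n (M * N)
  · have h' : IsCoprime (n : ℤ) ((M * N : ℕ) : ℤ) := Nat.isCoprime_iff_coprime.2 h
    have h1 := χ.changeLevel_eq_cast_of_dvd' (M.dvd_mul_right N) h'
    have h2 := ν.changeLevel_eq_cast_of_dvd' (N.dvd_mul_left M) h'
    simp only [Int.cast_natCast] at h1 h2
    rw [h1, h2]
  · rw [MulChar.map_nonunit _ (by rwa [ZMod.isUnit_iff_coprime]), zero_mul]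
    rw [Nat.coprime_mul_iff_right, not_and_or] at h
    rcases h with h | h
    · rw [MulChar.map_nonunit χ (by rwa [ZMod.isUnit_iff_coprime]), zero_mul]
    · rw [MulChar.map_nonunit ν (by rwa [ZMod.isUnit_iff_coprime]), map_zero, mul_zero]

/-- The second moment of the coefficients of `L(s, χ) L(s, ν)`. -/
lemma exists_tsum_norm_convolution_sq_le {M N : ℕ} [NeZero M] [NeZero N]
    (χ : DirichletCharacter ℂ M) (ν : DirichletCharacter ℂ N)
    (hne : χ.changeLevel (M.dvd_mul_right N) ≠ ν.changeLevel (N.dvd_mul_left M)) :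
    ∃ C : ℝ, ∀ η : ℝ, 0 < η → η ≤ 1 →
      Summable (fun n : ℕ ↦ ‖LSeries.convolution (χ ·) (ν ·) n‖ ^ 2 * (n : ℝ) ^ (-(1 + η))) ∧
      ∑' n : ℕ, ‖LSeries.convolution (χ ·) (ν ·) n‖ ^ 2 * (n : ℝ) ^ (-(1 + η)) ≤ C / η ^ 2 := by
  obtain ⟨B, hB⟩ := exists_tsum_one_div_rpow_le
  set ψ := χ.changeLevel (M.dvd_mul_right N) * (ν.changeLevel (N.dvd_mul_left M))⁻¹ with hψ
  have hψ1 : ψ ≠ 1 := fun h ↦ hne (mul_inv_eq_one.1 h)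
  obtain ⟨D, hD⟩ := (isCompact_Icc (a := (0 : ℝ)) (b := 1)).exists_bound_of_continuousOn
    (f := fun η : ℝ ↦ ψ.LFunction (1 + η))
    ((DirichletCharacter.differentiable_LFunction hψ1).continuous.comp (by fun_prop)).continuousOn
  refine ⟨B ^ 2 * D ^ 2, fun η h0 h1 ↦ ?_⟩
  have hη : (0 : ℝ) < 1 + η := by linarith
  have hz : Summable fun n : ℕ ↦ 1 / (n : ℝ) ^ (1 + η) :=
    Real.summable_one_div_nat_rpow.2 (by linarith)
  have hzp : Summable fun n : ℕ+ ↦ 1 / ((n : ℕ) : ℝ) ^ (1 + η) :=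
    hz.comp_injective PNat.coe_injective
  have hzle : ∑' n : ℕ+, 1 / ((n : ℕ) : ℝ) ^ (1 + η) ≤ B / η := by
    rw [((hasSum_pnat_iff_of_map_zero (f := fun n : ℕ ↦ 1 / (n : ℝ) ^ (1 + η))
      (by simp [Real.zero_rpow hη.ne'])).2 hz.hasSum).tsum_eq]
    exact hB η h0 h1
  have hsum : ∀ {K : ℕ} (ω : DirichletCharacter ℂ K),
      Summable (fun n : ℕ+ ↦ ‖twistHom ω ((1 + η) / 2) n‖ ^ 2) ∧
      ∑' n : ℕ+, ‖twistHom ω ((1 + η) / 2) n‖ ^ 2 ≤ B / η := fun ω ↦ by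
    have h : Summable (fun n : ℕ+ ↦ ‖twistHom ω ((1 + η) / 2) n‖ ^ 2) :=
      .of_nonneg_of_le (fun _ ↦ sq_nonneg _) (fun n ↦ norm_twistHom_sq_le ω _ n) hzp
    exact ⟨h, (h.tsum_le_tsum (fun n : ℕ+ ↦ norm_twistHom_sq_le ω _ (n : ℕ)) hzp).trans hzle⟩
  obtain ⟨hS, hle⟩ := tsum_norm_sq_convolution_le (twistHom χ ((1 + η) / 2))
    (twistHom ν ((1 + η) / 2)) (hsum χ).1 (hsum ν).1
  have hrpow : ∀ n : ℕ, (n : ℝ) ^ (-((1 + η) / 2)) * (n : ℝ) ^ (-((1 + η) / 2)) =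
      (n : ℝ) ^ (-(1 + η)) := fun n ↦ by
    rcases Nat.eq_zero_or_pos n with rfl | hn
    · rw [Nat.cast_zero, Real.zero_rpow (by linarith), Real.zero_rpow (by linarith), mul_zero]
    · rw [← Real.rpow_add (by exact_mod_cast hn)]; ring_nf
  have hterm : ∀ n : ℕ, ‖∑ x ∈ n.divisorsAntidiagonal,
      twistHom χ ((1 + η) / 2) x.1 * twistHom ν ((1 + η) / 2) x.2‖ ^ 2 =
      ‖LSeries.convolution (χ ·) (ν ·) n‖ ^ 2 * (n : ℝ) ^ (-(1 + η)) := fun n ↦ by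
    have : ∑ x ∈ n.divisorsAntidiagonal,
        twistHom χ ((1 + η) / 2) x.1 * twistHom ν ((1 + η) / 2) x.2 =
        LSeries.convolution (χ ·) (ν ·) n * (((n : ℝ) ^ (-((1 + η) / 2)) : ℝ) : ℂ) := by
      rw [LSeries.convolution_def, Finset.sum_mul]
      refine Finset.sum_congr rfl fun x hx ↦ ?_
      rw [← (Nat.mem_divisorsAntidiagonal.1 hx).1, Nat.cast_mul,
        Real.mul_rpow (Nat.cast_nonneg _) (Nat.cast_nonneg _), twistHom_apply, twistHom_apply]
      push_cast
      ring
    rw [this, norm_mul, norm_real, Real.norm_of_nonneg (by positivity), mul_pow, ← hrpow, sq, sq]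
  have hL : ∑' n : ℕ+, twistHom χ ((1 + η) / 2) n * starRingEnd ℂ (twistHom ν ((1 + η) / 2) n) =
      ψ.LFunction (1 + η) := by
    have hre : 1 < (1 + η : ℂ).re := by simpa using h0
    rw [DirichletCharacter.LFunction_eq_LSeries _ hre]
    have hs : Summable (fun n ↦ LSeries.term (ψ ·) (1 + η) n) :=
      ψ.LSeriesSummable_of_one_lt_re hre
    rw [LSeries, ← ((hasSum_pnat_iff_of_map_zero (LSeries.term_zero _ _)).2 hs.hasSum).tsum_eq]
    refine tsum_congr fun n ↦ ?_
    rw [LSeries.term_of_ne_zero n.ne_zero, hψ, changeLevel_mul_inv_apply, twistHom_apply,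
      twistHom_apply, map_mul, conj_ofReal, mul_mul_mul_comm, ← ofReal_mul, hrpow, div_eq_mul_inv,
      Real.rpow_neg (Nat.cast_nonneg _), ofReal_inv, ofReal_cpow (Nat.cast_nonneg _)]
    simp
  simp only [hterm] at hS hle
  have hz0 : LSeries.convolution (χ ·) (ν ·) 0 = 0 := LSeries.convolution_map_zero _ _
  have hH := (hasSum_pnat_iff_of_map_zero (f := fun n : ℕ ↦
    ‖LSeries.convolution (χ ·) (ν ·) n‖ ^ 2 * (n : ℝ) ^ (-(1 + η))) (by simp [hz0])).1 hS.hasSum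
  refine ⟨hH.summable, hH.tsum_eq.trans_le (hle.trans ?_)⟩
  rw [hL]
  have hBη : 0 ≤ B / η := le_trans (tsum_nonneg fun _ ↦ by positivity) hzle
  calc _ ≤ (B / η) * (B / η) * D ^ 2 := by
        gcongr
        · exact (hsum χ).2
        · exact (hsum ν).2
        · exact hD η ⟨h0.le, h1⟩
    _ = _ := by field_simp

lemma div_sq_add_sq_le {R : ℝ} (hR : 1 ≤ R) (k : ℤ) :
    R ^ 2 / (R ^ 2 + (k : ℝ) ^ 2) ≤
      4 * R * (((k + 1 : ℤ) : ℝ) / (R + |((k + 1 : ℤ) : ℝ)|) - (k : ℝ) / (R + |(k : ℝ)|)) := by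
  have h0 : 0 < R := by linarith
  rcases le_or_gt 0 k with hk | hk
  · have hk' : (0 : ℝ) ≤ k := by exact_mod_cast hk
    rw [abs_of_nonneg hk', abs_of_nonneg (by push_cast; linarith)]
    push_cast
    rw [div_sub_div _ _ (by positivity) (by positivity), ← mul_div_assoc,
      div_le_div_iff₀ (by positivity) (by positivity)]
    nlinarith [mul_nonneg h0.le hk', sq_nonneg (R - k), mul_nonneg (sq_nonneg R) hk',
      mul_nonneg (sq_nonneg R) (sq_nonneg (R - k)), mul_nonneg (sq_nonneg R) (mul_nonneg h0.le hk'),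
      mul_nonneg (sq_nonneg R) (sq_nonneg (k : ℝ)),
      mul_nonneg (sq_nonneg R) (mul_nonneg (sub_nonneg.2 hR) hk'),
      mul_nonneg (sq_nonneg R) (mul_nonneg (sub_nonneg.2 hR) h0.le)]
  · have hk' : (k : ℝ) + 1 ≤ 0 := by exact_mod_cast hk
    obtain ⟨j, hj⟩ : ∃ j : ℝ, j = -(k + 1) := ⟨_, rfl⟩
    have hj0 : 0 ≤ j := by linarith
    have e : (k : ℝ) = -(j + 1) := by linarith
    rw [abs_of_nonpos (by push_cast; linarith), abs_of_nonpos (by linarith)]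
    push_cast
    rw [e]
    rw [show -(j + 1) + 1 = -j by ring, neg_neg, neg_neg, neg_sq,
      show -j / (R + j) - -(j + 1) / (R + (j + 1)) = R / ((R + j) * (R + (j + 1))) by
        field_simp; ring, ← mul_div_assoc,
      div_le_div_iff₀ (by positivity) (by positivity)]
    have : (R + j) * (R + (j + 1)) ≤ 4 * (R ^ 2 + (j + 1) ^ 2) := by
      nlinarith [sq_nonneg (R - j), sq_nonneg (R - j - 1)]
    nlinarith [sq_nonneg R, mul_le_mul_of_nonneg_left this (sq_nonneg R)]

lemma sum_div_sq_add_sq_le {R : ℝ} (hR : 1 ≤ R) (m : ℕ) (s : Finset ℕ) :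
    ∑ n ∈ s, R ^ 2 / (R ^ 2 + ((n : ℝ) - m) ^ 2) ≤ 8 * R := by
  have h0 : 0 < R := by linarith
  set g : ℤ → ℝ := fun k ↦ (k : ℝ) / (R + |(k : ℝ)|) with hg
  have hg1 : ∀ k, |g k| ≤ 1 := fun k ↦ by
    rw [hg, abs_div, abs_of_pos (by positivity : 0 < R + |(k : ℝ)|)]
    exact div_le_one_of_le₀ (by linarith) (by positivity)
  obtain ⟨N, hN⟩ := s.exists_nat_subset_range
  calc _ ≤ ∑ n ∈ range N, R ^ 2 / (R ^ 2 + ((n : ℝ) - m) ^ 2) :=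
        Finset.sum_le_sum_of_subset_of_nonneg hN fun _ _ _ ↦ by positivity
    _ ≤ ∑ n ∈ range N, 4 * R * (g (((n + 1 : ℕ) : ℤ) - m) - g ((n : ℤ) - m)) := by
        refine Finset.sum_le_sum fun n _ ↦ ?_
        have := div_sq_add_sq_le hR ((n : ℤ) - m)
        rw [show ((n : ℤ) - m + 1 : ℤ) = ((n + 1 : ℕ) : ℤ) - m by push_cast; ring] at this
        refine le_trans (le_of_eq ?_) this
        push_cast; rfl
    _ ≤ 4 * R * 2 := by
        rw [← Finset.mul_sum, Finset.sum_range_sub (fun n : ℕ ↦ g ((n : ℤ) - m))]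
        gcongr
        have h1 := abs_le.1 (hg1 ((N : ℤ) - m))
        have h2 := abs_le.1 (hg1 (((0 : ℕ) : ℤ) - m))
        linarith
    _ = _ := by ring

/-- The Gaussian kernel in the mean value theorem decays quadratically off the diagonal. -/
lemma exp_neg_sq_log_sub_le {T : ℝ} (hT : 1 ≤ T) {m n : ℕ} (hm : m ≠ 0) (hn : n ≠ 0) :
    Real.exp (-(T ^ 2 * (Real.log n - Real.log m) ^ 2 / 4)) ≤
      (1 + 8 * Real.exp 8) * ((1 + m / T) ^ 2 / ((1 + m / T) ^ 2 + ((n : ℝ) - m) ^ 2)) := by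
  have hm' : (0 : ℝ) < m := by positivity
  have hn' : (0 : ℝ) < n := by positivity
  have hT0 : 0 < T := by linarith
  obtain ⟨L, hL⟩ : ∃ L, L = Real.log n - Real.log m := ⟨_, rfl⟩
  rw [← hL]
  have hnm : (n : ℝ) - m = m * (Real.exp L - 1) := by
    rw [hL, Real.exp_sub, Real.exp_log hn', Real.exp_log hm']; field_simp
  have h1 : |Real.exp L - 1| ≤ |L| * Real.exp |L| := by
    have key : ∀ x : ℝ, 0 ≤ x → Real.exp x - 1 ≤ x * Real.exp x := fun x _ ↦ by
      have h := Real.add_one_le_exp (-x)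
      have h2 := Real.exp_pos x
      have h3 : Real.exp x * Real.exp (-x) = 1 := by rw [← Real.exp_add]; simp
      nlinarith
    rcases le_total 0 L with h | h
    · rw [abs_of_nonneg h, abs_of_nonneg (by linarith [Real.add_one_le_exp L])]
      exact key L h
    · rw [abs_of_nonpos h, abs_of_nonpos (by linarith [Real.exp_le_one_iff.2 h])]
      have h2 := Real.add_one_le_exp L
      have h3 := Real.one_le_exp (neg_nonneg.2 h)
      nlinarith
  set k := Real.exp (-(T ^ 2 * L ^ 2 / 4)) with hk
  have hk1 : k ≤ 1 := Real.exp_le_one_iff.2 (by have : 0 ≤ T ^ 2 * L ^ 2 / 4 := by positivity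
                                                linarith)
  have hk0 : 0 < k := Real.exp_pos _
  have h2 : k * (T * (Real.exp L - 1)) ^ 2 ≤ 8 * Real.exp 8 := by
    have h3 : (T * (Real.exp L - 1)) ^ 2 ≤ T ^ 2 * L ^ 2 * Real.exp (8 + L ^ 2 / 8) := by
      calc (T * (Real.exp L - 1)) ^ 2 = T ^ 2 * |Real.exp L - 1| ^ 2 := by rw [sq_abs]; ring
        _ ≤ T ^ 2 * (|L| * Real.exp |L|) ^ 2 := by gcongr
        _ = T ^ 2 * L ^ 2 * Real.exp (2 * |L|) := by
            rw [mul_pow, sq_abs, ← Real.exp_nat_mul]; push_cast; ring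
        _ ≤ _ := by
            gcongr
            nlinarith [sq_nonneg (|L| - 8), sq_abs L]
    have h4 : k * Real.exp (8 + L ^ 2 / 8) ≤ Real.exp 8 * Real.exp (-(T ^ 2 * L ^ 2 / 8)) := by
      rw [hk, ← Real.exp_add, ← Real.exp_add]
      refine Real.exp_le_exp.2 ?_
      nlinarith [mul_le_mul_of_nonneg_right (one_le_pow₀ hT : 1 ≤ T ^ 2) (sq_nonneg L)]
    have h5 : T ^ 2 * L ^ 2 * Real.exp (-(T ^ 2 * L ^ 2 / 8)) ≤ 8 := by
      have := Real.add_one_le_exp (T ^ 2 * L ^ 2 / 8)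
      rw [Real.exp_neg, ← div_eq_mul_inv, div_le_iff₀ (Real.exp_pos _)]
      linarith
    calc _ ≤ k * (T ^ 2 * L ^ 2 * Real.exp (8 + L ^ 2 / 8)) := by gcongr
      _ = T ^ 2 * L ^ 2 * (k * Real.exp (8 + L ^ 2 / 8)) := by ring
      _ ≤ T ^ 2 * L ^ 2 * (Real.exp 8 * Real.exp (-(T ^ 2 * L ^ 2 / 8))) := by gcongr
      _ = Real.exp 8 * (T ^ 2 * L ^ 2 * Real.exp (-(T ^ 2 * L ^ 2 / 8))) := by ring
      _ ≤ Real.exp 8 * 8 := by gcongr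
      _ = _ := by ring
  rw [← mul_div_assoc, le_div_iff₀ (by positivity)]
  have h6 : k * ((n : ℝ) - m) ^ 2 ≤ 8 * Real.exp 8 * (1 + m / T) ^ 2 := by
    calc k * ((n : ℝ) - m) ^ 2 = k * (T * (Real.exp L - 1)) ^ 2 * (m / T) ^ 2 := by
          rw [hnm]; field_simp
      _ ≤ 8 * Real.exp 8 * (1 + m / T) ^ 2 := by gcongr; linarith
  have h7 : k * (1 + m / T) ^ 2 ≤ 1 * (1 + m / T) ^ 2 := by gcongr
  linarith

lemma sum_exp_neg_sq_log_sub_le {T : ℝ} (hT : 1 ≤ T) {m : ℕ} (hm : m ≠ 0) (s : Finset ℕ)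
    (hs : ∀ n ∈ s, n ≠ 0) :
    T * ∑ n ∈ s, Real.exp (-(T ^ 2 * (Real.log n - Real.log m) ^ 2 / 4)) ≤
      (8 + 64 * Real.exp 8) * (T + m) := by
  have hR : 1 ≤ 1 + m / T := le_add_of_nonneg_right (by positivity)
  calc _ ≤ T * ∑ n ∈ s, (1 + 8 * Real.exp 8) *
        ((1 + m / T) ^ 2 / ((1 + m / T) ^ 2 + ((n : ℝ) - m) ^ 2)) := by
        gcongr with n hn
        exact exp_neg_sq_log_sub_le hT hm (hs n hn)
    _ ≤ T * ((1 + 8 * Real.exp 8) * (8 * (1 + m / T))) := by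
        rw [← Finset.mul_sum]
        gcongr
        exact sum_div_sq_add_sq_le hR m s
    _ = _ := by field_simp; ring

lemma natCast_cpow_neg_mul_I {n : ℕ} (hn : n ≠ 0) (t : ℝ) :
    (n : ℂ) ^ (-(t * I)) = cexp (-(I * t * Real.log n)) := by
  rw [cpow_def_of_ne_zero (by exact_mod_cast hn), natCast_log]
  ring_nf

lemma norm_natCast_cpow_neg_mul_I_le (n : ℕ) (t : ℝ) : ‖(n : ℂ) ^ (-(t * I))‖ ≤ 1 := by
  rcases eq_or_ne n 0 with rfl | hn
  · rcases eq_or_ne t 0 with rfl | ht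
    · simp
    · rw [Nat.cast_zero, zero_cpow (by simpa using ht)]; simp
  · rw [norm_natCast_cpow_of_pos (Nat.pos_of_ne_zero hn)]; simp

lemma integrable_gaussian_weight {T : ℝ} (hT : 0 < T) :
    Integrable fun t : ℝ ↦ Real.exp (-(t ^ 2 / T ^ 2)) := by
  convert integrable_exp_neg_mul_sq (b := 1 / T ^ 2) (by positivity) using 3
  ring

lemma integrable_phase_mul_gaussian_weight {T : ℝ} (hT : 0 < T) (x : ℝ) :
    Integrable fun t : ℝ ↦ cexp (I * t * x) * (Real.exp (-(t ^ 2 / T ^ 2)) : ℂ) := by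
  refine ((integrable_gaussian_weight hT).ofReal (𝕜 := ℂ)).bdd_mul (c := 1) ?_ ?_
  · exact Continuous.aestronglyMeasurable (by fun_prop)
  · refine Eventually.of_forall fun t ↦ ?_
    rw [Complex.norm_exp]; simp

lemma norm_integral_phase_mul_gaussian_weight {T : ℝ} (hT : 0 < T) (x : ℝ) :
    ‖∫ t : ℝ, cexp (I * t * x) * (Real.exp (-(t ^ 2 / T ^ 2)) : ℂ)‖ =
      √π * T * Real.exp (-(T ^ 2 * x ^ 2 / 4)) := by
  have hb : 0 < ((1 / T ^ 2 : ℝ) : ℂ).re := by rw [ofReal_re]; positivity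
  have h := fourierIntegral_gaussian hb x
  have e : (fun t : ℝ ↦ cexp (I * t * x) * (Real.exp (-(t ^ 2 / T ^ 2)) : ℂ)) =
      fun t : ℝ ↦ cexp (I * x * t) * cexp (-((1 / T ^ 2 : ℝ) : ℂ) * t ^ 2) := by
    ext t
    push_cast
    congr 2 <;> ring
  rw [e, h, norm_mul, ← ofReal_div, norm_cpow_eq_rpow_re_of_pos (by positivity), Complex.norm_exp]
  congr 1
  · rw [show (1 / 2 : ℂ).re = 1 / 2 by simp, ← Real.sqrt_eq_rpow,
      show π / (1 / T ^ 2) = π * T ^ 2 by field_simp, Real.sqrt_mul Real.pi_pos.le,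
      Real.sqrt_sq hT.le]
  · rw [show -(x : ℂ) ^ 2 / (4 * ((1 / T ^ 2 : ℝ) : ℂ)) = ((-(T ^ 2 * x ^ 2 / 4) : ℝ) : ℂ) by
      push_cast; field_simp, ofReal_re]

/-- The weighted mean value theorem for Dirichlet polynomials. -/
lemma integral_norm_sq_sum_mul_gaussian_le {T : ℝ} (hT : 1 ≤ T) (s : Finset ℕ)
    (hs : ∀ n ∈ s, n ≠ 0) (c : ℕ → ℂ) :
    ∫ t : ℝ, ‖∑ n ∈ s, c n * (n : ℂ) ^ (-(t * I))‖ ^ 2 * Real.exp (-(t ^ 2 / T ^ 2)) ≤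
      √π * (8 + 64 * Real.exp 8) * ∑ n ∈ s, (T + n) * ‖c n‖ ^ 2 := by
  have hT0 : 0 < T := by linarith
  set K : ℕ → ℕ → ℝ := fun m n ↦
    Real.exp (-(T ^ 2 * (Real.log n - Real.log m) ^ 2 / 4)) with hK
  have hKs : ∀ m n, K m n = K n m := fun m n ↦ by
    simp only [hK]; congr 3; ring
  set G : ℕ → ℕ → ℝ → ℂ := fun m n t ↦ c m * starRingEnd ℂ (c n) *
    (cexp (I * t * ((Real.log n - Real.log m : ℝ) : ℂ)) * (Real.exp (-(t ^ 2 / T ^ 2)) : ℂ)) with hG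
  have hGi : ∀ m n, Integrable (G m n) := fun m n ↦
    (integrable_phase_mul_gaussian_weight hT0 _).const_mul _
  have e1 : ∀ t : ℝ, ((‖∑ n ∈ s, c n * (n : ℂ) ^ (-(t * I))‖ ^ 2 *
      Real.exp (-(t ^ 2 / T ^ 2)) : ℝ) : ℂ) = ∑ m ∈ s, ∑ n ∈ s, G m n t := fun t ↦ by
    rw [ofReal_mul, ofReal_pow, ← Complex.mul_conj', map_sum, Finset.sum_mul_sum, Finset.sum_mul]
    refine Finset.sum_congr rfl fun m hm ↦ ?_
    rw [Finset.sum_mul]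
    refine Finset.sum_congr rfl fun n hn ↦ ?_
    rw [natCast_cpow_neg_mul_I (hs m hm), natCast_cpow_neg_mul_I (hs n hn), map_mul,
      ← Complex.exp_conj, hG]
    simp only [map_neg, map_mul, conj_I, conj_ofReal]
    rw [show I * (t : ℂ) * ((Real.log n - Real.log m : ℝ) : ℂ) =
      -(I * t * Real.log m) + -(-I * t * Real.log n) by push_cast; ring, Complex.exp_add]
    ring
  have e2 : ((∫ t : ℝ, ‖∑ n ∈ s, c n * (n : ℂ) ^ (-(t * I))‖ ^ 2 *
      Real.exp (-(t ^ 2 / T ^ 2)) : ℝ) : ℂ) = ∑ m ∈ s, ∑ n ∈ s, ∫ t, G m n t := by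
    rw [← integral_complex_ofReal]
    simp_rw [e1]
    rw [integral_finsetSum _ fun m _ ↦ integrable_finsetSum _ fun n _ ↦ hGi m n]
    exact Finset.sum_congr rfl fun m _ ↦ integral_finsetSum _ fun n _ ↦ hGi m n
  have hGn : ∀ m n, ‖∫ t, G m n t‖ ≤
      √π * T * ((‖c m‖ ^ 2 * K m n + ‖c n‖ ^ 2 * K m n) / 2) := fun m n ↦ by
    rw [hG, integral_const_mul, norm_mul, norm_integral_phase_mul_gaussian_weight hT0, norm_mul,
      RCLike.norm_conj]
    have : ‖c m‖ * ‖c n‖ ≤ (‖c m‖ ^ 2 + ‖c n‖ ^ 2) / 2 := by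
      nlinarith [sq_nonneg (‖c m‖ - ‖c n‖)]
    calc _ ≤ (‖c m‖ ^ 2 + ‖c n‖ ^ 2) / 2 * (√π * T * K m n) := by gcongr
      _ = _ := by ring
  have e3 : ∑ m ∈ s, ∑ n ∈ s, ‖c n‖ ^ 2 * K m n = ∑ m ∈ s, ∑ n ∈ s, ‖c m‖ ^ 2 * K m n := by
    rw [Finset.sum_comm]
    exact Finset.sum_congr rfl fun m _ ↦ Finset.sum_congr rfl fun n _ ↦ by rw [hKs]
  calc _ ≤ ‖((∫ t : ℝ, ‖∑ n ∈ s, c n * (n : ℂ) ^ (-(t * I))‖ ^ 2 *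
      Real.exp (-(t ^ 2 / T ^ 2)) : ℝ) : ℂ)‖ := by rw [norm_real]; exact le_abs_self _
    _ ≤ ∑ m ∈ s, ∑ n ∈ s, √π * T * ((‖c m‖ ^ 2 * K m n + ‖c n‖ ^ 2 * K m n) / 2) := by
        rw [e2]
        exact norm_sum_le_of_le _ fun m _ ↦ norm_sum_le_of_le _ fun n _ ↦ hGn m n
    _ = √π * T * ∑ m ∈ s, ∑ n ∈ s, ‖c m‖ ^ 2 * K m n := by
        simp_rw [← Finset.mul_sum, ← Finset.sum_div, Finset.sum_add_distrib, e3]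
        simp_rw [← Finset.mul_sum]
        ring
    _ = √π * ∑ m ∈ s, ‖c m‖ ^ 2 * (T * ∑ n ∈ s, K m n) := by
        rw [mul_assoc, Finset.mul_sum]
        congr 1
        refine Finset.sum_congr rfl fun m _ ↦ ?_
        rw [← Finset.mul_sum]; ring
    _ ≤ √π * ∑ m ∈ s, ‖c m‖ ^ 2 * ((8 + 64 * Real.exp 8) * (T + m)) := by
        refine mul_le_mul_of_nonneg_left (Finset.sum_le_sum fun m hm ↦ ?_) (Real.sqrt_nonneg _)
        exact mul_le_mul_of_nonneg_left (sum_exp_neg_sq_log_sub_le hT (hs m hm) s hs) (sq_nonneg _)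
    _ = _ := by
        rw [mul_assoc √π]
        congr 1
        rw [Finset.mul_sum]
        exact Finset.sum_congr rfl fun m _ ↦ by ring

lemma continuous_tsum_mul_cpow {c : ℕ → ℂ} (hc : Summable fun n ↦ ‖c n‖) (h0 : c 0 = 0) :
    Continuous fun t : ℝ ↦ ∑' n, c n * (n : ℂ) ^ (-(t * I)) := by
  refine continuous_tsum (fun n ↦ ?_) hc fun n t ↦ ?_
  · rcases eq_or_ne n 0 with rfl | hn
    · simpa [h0] using continuous_const
    · have : NeZero (n : ℂ) := ⟨by exact_mod_cast hn⟩
      fun_prop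
  · rw [norm_mul]
    exact mul_le_of_le_one_right (norm_nonneg _) (norm_natCast_cpow_neg_mul_I_le n t)

lemma norm_tsum_mul_cpow_le {c : ℕ → ℂ} (hc : Summable fun n ↦ ‖c n‖) (t : ℝ) :
    ‖∑' n, c n * (n : ℂ) ^ (-(t * I))‖ ≤ ∑' n, ‖c n‖ :=
  tsum_of_norm_bounded hc.hasSum fun n ↦ by
    rw [norm_mul]
    exact mul_le_of_le_one_right (norm_nonneg _) (norm_natCast_cpow_neg_mul_I_le n t)

lemma integrable_norm_sq_tsum_mul_gaussian {T : ℝ} (hT : 0 < T) {c : ℕ → ℂ}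
    (hc : Summable fun n ↦ ‖c n‖) (h0 : c 0 = 0) :
    Integrable fun t : ℝ ↦
      ‖∑' n, c n * (n : ℂ) ^ (-(t * I))‖ ^ 2 * Real.exp (-(t ^ 2 / T ^ 2)) := by
  refine (integrable_gaussian_weight hT).bdd_mul (c := (∑' n, ‖c n‖) ^ 2) ?_ ?_
  · exact ((continuous_tsum_mul_cpow hc h0).norm.pow 2).aestronglyMeasurable
  · refine Eventually.of_forall fun t ↦ ?_
    rw [norm_pow, norm_norm]
    gcongr
    exact norm_tsum_mul_cpow_le hc t

/-- The weighted mean value theorem for absolutely convergent Dirichlet series. -/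
lemma integral_norm_sq_tsum_mul_gaussian_le {T : ℝ} (hT : 1 ≤ T) {c : ℕ → ℂ}
    (hc : Summable fun n ↦ ‖c n‖) (h0 : c 0 = 0)
    (hc2 : Summable fun n : ℕ ↦ (T + n) * ‖c n‖ ^ 2) :
    ∫ t : ℝ, ‖∑' n, c n * (n : ℂ) ^ (-(t * I))‖ ^ 2 * Real.exp (-(t ^ 2 / T ^ 2)) ≤
      √π * (8 + 64 * Real.exp 8) * ∑' n : ℕ, (T + n) * ‖c n‖ ^ 2 := by
  have hT0 : 0 < T := by linarith
  have hsum : ∀ t : ℝ, Summable fun n : ℕ ↦ c n * (n : ℂ) ^ (-(t * I)) := fun t ↦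
    Summable.of_norm_bounded hc fun n ↦ by
      rw [norm_mul]
      exact mul_le_of_le_one_right (norm_nonneg _) (norm_natCast_cpow_neg_mul_I_le n t)
  have herase : ∀ (N : ℕ) (t : ℝ), ∑ n ∈ range N, c n * (n : ℂ) ^ (-(t * I)) =
      ∑ n ∈ (range N).erase 0, c n * (n : ℂ) ^ (-(t * I)) := fun N t ↦
    (Finset.sum_erase _ (by simp [h0])).symm
  have hlim : Tendsto (fun N : ℕ ↦
      ∫ t : ℝ, ‖∑ n ∈ (range N).erase 0, c n * (n : ℂ) ^ (-(t * I))‖ ^ 2 *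
      Real.exp (-(t ^ 2 / T ^ 2))) atTop (nhds (∫ t : ℝ, ‖∑' n, c n * (n : ℂ) ^ (-(t * I))‖ ^ 2 *
      Real.exp (-(t ^ 2 / T ^ 2)))) := by
    refine tendsto_integral_of_dominated_convergence
      (fun t ↦ (∑' n, ‖c n‖) ^ 2 * Real.exp (-(t ^ 2 / T ^ 2))) (fun N ↦ ?_)
      ((integrable_gaussian_weight hT0).const_mul _) (fun N ↦ ?_) ?_
    · refine Continuous.aestronglyMeasurable ?_
      refine Continuous.mul ((continuous_finsetSum _ fun n hn ↦ ?_).norm.pow 2) (by fun_prop)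
      have : NeZero (n : ℂ) := ⟨by exact_mod_cast (Finset.mem_erase.1 hn).1⟩
      fun_prop
    · refine Eventually.of_forall fun t ↦ ?_
      rw [norm_mul, norm_pow, norm_norm, Real.norm_of_nonneg (Real.exp_pos _).le]
      gcongr
      refine (norm_sum_le _ _).trans (le_trans (Finset.sum_le_sum fun n _ ↦ ?_)
        (hc.sum_le_tsum _ fun n _ ↦ norm_nonneg _))
      rw [norm_mul]
      exact mul_le_of_le_one_right (norm_nonneg _) (norm_natCast_cpow_neg_mul_I_le n t)
    · refine Eventually.of_forall fun t ↦ ?_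
      simp_rw [← herase]
      exact ((hsum t).hasSum.tendsto_sum_nat.norm.pow 2).mul_const _
  refine le_of_tendsto' hlim fun N ↦ ?_
  refine (integral_norm_sq_sum_mul_gaussian_le hT _
    (fun n hn ↦ (Finset.mem_erase.1 hn).1) c).trans ?_
  gcongr
  exact hc2.sum_le_tsum _ fun n _ ↦ by positivity

lemma integral_vertical_line_shift {g : ℂ → ℂ} {T K : ℝ} (hT : 0 < T)
    (hd : ∀ s : ℂ, 1 / 2 ≤ s.re → s.re ≤ 3 / 2 → DifferentiableAt ℂ g s)
    (hg : ∀ s : ℂ, 1 / 2 ≤ s.re → s.re ≤ 3 / 2 → ‖g s‖ ≤ K * Real.exp (-(s.im ^ 2 / T ^ 2))) :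
    ∫ t : ℝ, g ((1 / 2 : ℝ) + t * I) = ∫ t : ℝ, g ((3 / 2 : ℝ) + t * I) := by
  have hcont : ∀ σ : ℝ, 1 / 2 ≤ σ → σ ≤ 3 / 2 → Continuous fun t : ℝ ↦ g (σ + t * I) :=
    fun σ h1 h2 ↦ continuous_iff_continuousAt.2 fun t ↦
      ContinuousAt.comp (f := fun t : ℝ ↦ (σ + t * I : ℂ)) (g := g)
        (hd _ (by simpa using h1) (by simpa using h2)).continuousAt (by fun_prop)
  have hint : ∀ σ : ℝ, 1 / 2 ≤ σ → σ ≤ 3 / 2 → Integrable fun t : ℝ ↦ g (σ + t * I) :=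
    fun σ h1 h2 ↦ ((integrable_gaussian_weight hT).const_mul K).mono'
      (hcont σ h1 h2).aestronglyMeasurable (Eventually.of_forall fun t ↦ by
        simpa using hg (σ + t * I) (by simpa using h1) (by simpa using h2))
  have hlim : ∀ σ : ℝ, 1 / 2 ≤ σ → σ ≤ 3 / 2 → Tendsto (fun R : ℝ ↦ ∫ t in (-R)..R, g (σ + t * I))
      atTop (nhds (∫ t : ℝ, g (σ + t * I))) := fun σ h1 h2 ↦
    intervalIntegral_tendsto_integral (hint σ h1 h2) tendsto_neg_atTop_atBot tendsto_id
  have hhor : ∀ R : ℝ, ‖∫ x : ℝ in (1 / 2 : ℝ)..(3 / 2 : ℝ), g (x + R * I)‖ ≤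
      K * Real.exp (-(R ^ 2 / T ^ 2)) := fun R ↦ by
    refine (intervalIntegral.norm_integral_le_of_norm_le_const
      (C := K * Real.exp (-(R ^ 2 / T ^ 2))) fun x hx ↦ ?_).trans (by norm_num)
    rw [Set.uIoc_of_le (by norm_num)] at hx
    simpa using hg (x + R * I) (by simpa using hx.1.le) (by simpa using hx.2)
  have hzero : Tendsto (fun R : ℝ ↦ K * Real.exp (-(R ^ 2 / T ^ 2))) atTop (nhds 0) := by
    rw [← mul_zero K]
    refine (Real.tendsto_exp_neg_atTop_nhds_zero.comp ?_).const_mul K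
    exact (tendsto_pow_atTop two_ne_zero).atTop_div_const (by positivity)
  have h1 : Tendsto (fun R : ℝ ↦ ∫ x : ℝ in (1 / 2 : ℝ)..(3 / 2 : ℝ), g (x + R * I)) atTop
      (nhds 0) := squeeze_zero_norm hhor hzero
  have h2 : Tendsto (fun R : ℝ ↦ ∫ x : ℝ in (1 / 2 : ℝ)..(3 / 2 : ℝ), g (x + (-R : ℝ) * I)) atTop
      (nhds 0) := squeeze_zero_norm (fun R ↦ by simpa using hhor (-R)) hzero
  have key : ∀ R : ℝ, (∫ x : ℝ in (1 / 2 : ℝ)..(3 / 2 : ℝ), g (x + (-R : ℝ) * I)) -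
      (∫ x : ℝ in (1 / 2 : ℝ)..(3 / 2 : ℝ), g (x + R * I)) +
      I * (∫ t in (-R)..R, g ((3 / 2 : ℝ) + t * I)) -
      I * (∫ t in (-R)..R, g ((1 / 2 : ℝ) + t * I)) = 0 := fun R ↦ by
    have := Complex.integral_boundary_rect_eq_zero_of_differentiableOn g
      ((1 / 2 : ℝ) + (-R : ℝ) * I) ((3 / 2 : ℝ) + R * I) fun s hs ↦ by
        rw [mem_reProdIm] at hs
        have h := hs.1
        simp only [add_re, ofReal_re, mul_re, ofReal_im, I_re, I_im, mul_zero, zero_mul,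
          sub_zero, add_zero] at h
        rw [Set.uIcc_of_le (by norm_num)] at h
        exact (hd s h.1 h.2).differentiableWithinAt
    simpa using this
  have := ((h2.sub h1).add ((hlim (3 / 2) (by norm_num) le_rfl).const_mul I)).sub
    ((hlim (1 / 2) le_rfl (by norm_num)).const_mul I)
  simp_rw [key] at this
  have h3 := tendsto_nhds_unique this tendsto_const_nhds
  have h4 : I * ((∫ t : ℝ, g ((3 / 2 : ℝ) + t * I)) - ∫ t : ℝ, g ((1 / 2 : ℝ) + t * I)) = 0 := by
    rw [← h3]; ring
  exact (sub_eq_zero.1 ((mul_eq_zero.1 h4).resolve_left I_ne_zero)).symm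

lemma norm_exp_sq_div (T σ t : ℝ) :
    ‖cexp ((σ + t * I) ^ 2 / (T : ℂ) ^ 2)‖ =
      Real.exp (σ ^ 2 / T ^ 2) * Real.exp (-(t ^ 2 / T ^ 2)) := by
  rw [Complex.norm_exp, ← Real.exp_add, show (σ + t * I : ℂ) ^ 2 / (T : ℂ) ^ 2 =
    ((σ ^ 2 / T ^ 2 + -(t ^ 2 / T ^ 2) : ℝ) : ℂ) + ((2 * σ * t / T ^ 2 : ℝ) : ℂ) * I by
      push_cast; rw [add_sq, mul_pow, I_sq]; ring]
  rw [add_re, ofReal_re, re_ofReal_mul, I_re, mul_zero, add_zero]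

/-- A convexity estimate for mean squares on the lines `-1/2`, `1/2` and `3/2`. -/
lemma StripExpBounded.integral_norm_sq_half_le {h : ℂ → ℂ} (hb : StripExpBounded h)
    (hd : ∀ s : ℂ, s.re < 2 → DifferentiableAt ℂ h s) {T l : ℝ} (hT : 1 ≤ T) (hl : 0 < l) :
    (∀ σ : ℝ, -1 / 2 ≤ σ → σ ≤ 3 / 2 → Integrable fun t : ℝ ↦
      ‖h (σ + t * I)‖ ^ 2 * Real.exp (-(t ^ 2 / T ^ 2)) ^ 2) ∧
    ∫ t : ℝ, ‖h ((1 / 2 : ℝ) + t * I)‖ ^ 2 * Real.exp (-(t ^ 2 / T ^ 2)) ^ 2 ≤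
      Real.exp 5 * (l * (∫ t : ℝ, ‖h ((3 / 2 : ℝ) + t * I)‖ ^ 2 * Real.exp (-(t ^ 2 / T ^ 2)) ^ 2) +
        l⁻¹ * ∫ t : ℝ, ‖h ((-1 / 2 : ℝ) + t * I)‖ ^ 2 * Real.exp (-(t ^ 2 / T ^ 2)) ^ 2) := by
  have hT0 : 0 < T := by linarith
  obtain ⟨C, hC0, hC⟩ := hb.exists_nonneg
  have hgauss : ∀ t : ℝ, Real.exp (C * |t|) ^ 2 * Real.exp (-(t ^ 2 / T ^ 2)) ^ 2 ≤
      Real.exp (C ^ 2 * T ^ 2) * Real.exp (-(t ^ 2 / T ^ 2)) := fun t ↦ by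
    simp only [← Real.exp_nat_mul, ← Real.exp_add]
    refine Real.exp_le_exp.2 ?_
    have h1 : 0 ≤ (C * T - |t| / T) ^ 2 := sq_nonneg _
    have h2 : (C * T - |t| / T) ^ 2 = C ^ 2 * T ^ 2 - 2 * (C * |t|) + t ^ 2 / T ^ 2 := by
      rw [sub_sq, div_pow, sq_abs]; field_simp
    push_cast
    linarith
  have hcont : ∀ σ : ℝ, σ < 2 → Continuous fun t : ℝ ↦ h (σ + t * I) := fun σ h1 ↦
    continuous_iff_continuousAt.2 fun t ↦
      ContinuousAt.comp (f := fun t : ℝ ↦ (σ + t * I : ℂ)) (g := h)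
        (hd _ (by simpa using h1)).continuousAt (by fun_prop)
  have hint : ∀ σ : ℝ, -1 / 2 ≤ σ → σ ≤ 3 / 2 → Integrable fun t : ℝ ↦
      ‖h (σ + t * I)‖ ^ 2 * Real.exp (-(t ^ 2 / T ^ 2)) ^ 2 := fun σ h1 h2 ↦ by
    refine ((integrable_gaussian_weight hT0).const_mul (C ^ 2 * Real.exp (C ^ 2 * T ^ 2))).mono'
      (((hcont σ (by linarith)).norm.pow 2).mul (by fun_prop)).aestronglyMeasurable
      (Eventually.of_forall fun t ↦ ?_)
    rw [Real.norm_of_nonneg (by positivity)]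
    calc _ ≤ (C * Real.exp (C * |t|)) ^ 2 * Real.exp (-(t ^ 2 / T ^ 2)) ^ 2 := by
          gcongr
          simpa using hC (σ + t * I) (by simpa using h1) (by simpa using h2)
      _ = C ^ 2 * (Real.exp (C * |t|) ^ 2 * Real.exp (-(t ^ 2 / T ^ 2)) ^ 2) := by ring
      _ ≤ _ := by
          rw [mul_assoc]
          exact mul_le_mul_of_nonneg_left (hgauss t) (sq_nonneg C)
  refine ⟨hint, ?_⟩
  have hT2 : 1 ≤ T ^ 2 := one_le_pow₀ hT
  set f : ℂ → ℂ := fun s ↦ h s * cexp (s ^ 2 / (T : ℂ) ^ 2) with hf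
  have hfn : ∀ σ t : ℝ, ‖f (σ + t * I)‖ = Real.exp (σ ^ 2 / T ^ 2) *
      (‖h (σ + t * I)‖ * Real.exp (-(t ^ 2 / T ^ 2))) := fun σ t ↦ by
    rw [hf, norm_mul, norm_exp_sq_div]; ring
  set g : ℂ → ℂ := fun s ↦ f s * starRingEnd ℂ (f (1 - starRingEnd ℂ s)) with hg
  have hrefl : ∀ σ t : ℝ, 1 - starRingEnd ℂ (σ + t * I : ℂ) = ((1 - σ : ℝ) : ℂ) + t * I := by
    intro σ t
    simp only [map_add, map_mul, conj_ofReal, conj_I, ofReal_sub, ofReal_one]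
    ring
  have hgn : ∀ σ t : ℝ, ‖g (σ + t * I)‖ = Real.exp (σ ^ 2 / T ^ 2) *
      Real.exp ((1 - σ) ^ 2 / T ^ 2) * (‖h (σ + t * I)‖ * ‖h (((1 - σ : ℝ) : ℂ) + t * I)‖) *
      Real.exp (-(t ^ 2 / T ^ 2)) ^ 2 := fun σ t ↦ by
    rw [hg, norm_mul, RCLike.norm_conj, hrefl, hfn, hfn]; ring
  have hfd : ∀ s : ℂ, s.re < 2 → DifferentiableAt ℂ f s := fun s hs ↦
    (hd s hs).mul (by fun_prop)
  have hgd : ∀ s : ℂ, 1 / 2 ≤ s.re → s.re ≤ 3 / 2 → DifferentiableAt ℂ g s := fun s h1 h2 ↦ by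
    refine (hfd s (by linarith)).mul ?_
    have h3 : DifferentiableAt ℂ (fun z ↦ f (1 - z)) (starRingEnd ℂ s) :=
      DifferentiableAt.comp (f := fun z : ℂ ↦ 1 - z) (g := f) _
        (hfd _ (by simp only [sub_re, one_re, conj_re]; linarith)) (by fun_prop)
    have h4 := h3.conj_conj
    rw [conj_conj] at h4
    exact h4
  have hexp : ∀ σ : ℝ, -1 / 2 ≤ σ → σ ≤ 3 / 2 →
      Real.exp (σ ^ 2 / T ^ 2) ≤ Real.exp (9 / 4) := fun σ h1 h2 ↦ by
    refine Real.exp_le_exp.2 ((div_le_self (sq_nonneg _) hT2).trans ?_)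
    nlinarith
  have hgb : ∀ s : ℂ, 1 / 2 ≤ s.re → s.re ≤ 3 / 2 → ‖g s‖ ≤
      Real.exp (9 / 4) * Real.exp (9 / 4) * C ^ 2 * Real.exp (C ^ 2 * T ^ 2) *
        Real.exp (-(s.im ^ 2 / T ^ 2)) := fun s h1 h2 ↦ by
    conv_lhs => rw [← re_add_im s]
    rw [hgn]
    have b1 := hC (s.re + s.im * I) (by simp; linarith) (by simpa using h2)
    have b2 := hC (((1 - s.re : ℝ) : ℂ) + s.im * I) (by simp; linarith) (by simp; linarith)
    have e1 : (s.re + s.im * I : ℂ).im = s.im := by simp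
    have e2 : (((1 - s.re : ℝ) : ℂ) + s.im * I : ℂ).im = s.im := by simp
    rw [e1] at b1
    rw [e2] at b2
    calc _ ≤ Real.exp (9 / 4) * Real.exp (9 / 4) * ((C * Real.exp (C * |s.im|)) *
          (C * Real.exp (C * |s.im|))) * Real.exp (-(s.im ^ 2 / T ^ 2)) ^ 2 := by
          have b3 := hexp s.re (by linarith) h2
          have b4 := hexp (1 - s.re) (by linarith) (by linarith)
          gcongr ?_ * ?_ * ?_ * _
          gcongr
      _ = Real.exp (9 / 4) * Real.exp (9 / 4) * C ^ 2 *
          (Real.exp (C * |s.im|) ^ 2 * Real.exp (-(s.im ^ 2 / T ^ 2)) ^ 2) := by ring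
      _ ≤ Real.exp (9 / 4) * Real.exp (9 / 4) * C ^ 2 *
          (Real.exp (C ^ 2 * T ^ 2) * Real.exp (-(s.im ^ 2 / T ^ 2))) :=
          mul_le_mul_of_nonneg_left (hgauss _) (by positivity)
      _ = _ := by ring
  have hshift := integral_vertical_line_shift hT0 hgd hgb
  have hghalf : ∀ t : ℝ, g ((1 / 2 : ℝ) + t * I) = ((‖f ((1 / 2 : ℝ) + t * I)‖ ^ 2 : ℝ) : ℂ) :=
    fun t ↦ by
      rw [hg]
      simp only []
      rw [hrefl, show (1 - 1 / 2 : ℝ) = 1 / 2 by norm_num, mul_conj']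
      push_cast; rfl
  have hfi : Integrable fun t : ℝ ↦ ‖f ((1 / 2 : ℝ) + t * I)‖ ^ 2 := by
    simp_rw [hfn, mul_pow]
    exact (hint (1 / 2) (by norm_num) (by norm_num)).const_mul _
  calc _ ≤ ∫ t : ℝ, ‖f ((1 / 2 : ℝ) + t * I)‖ ^ 2 := by
        refine integral_mono (hint (1 / 2) (by norm_num) (by norm_num)) hfi fun t ↦ ?_
        simp only []
        rw [hfn, mul_pow, mul_pow]
        exact le_mul_of_one_le_left (by positivity)
          (one_le_pow₀ (Real.one_le_exp (by positivity)))
    _ ≤ ‖∫ t : ℝ, g ((1 / 2 : ℝ) + t * I)‖ := by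
        simp_rw [hghalf]
        rw [integral_complex_ofReal, norm_real]
        exact le_abs_self _
    _ ≤ ∫ t : ℝ, Real.exp 5 * (l * (‖h ((3 / 2 : ℝ) + t * I)‖ ^ 2 *
          Real.exp (-(t ^ 2 / T ^ 2)) ^ 2) + l⁻¹ * (‖h ((-1 / 2 : ℝ) + t * I)‖ ^ 2 *
          Real.exp (-(t ^ 2 / T ^ 2)) ^ 2)) := by
        rw [hshift]
        refine norm_integral_le_of_norm_le
          (((hint (3 / 2) (by norm_num) le_rfl).const_mul _).add
            ((hint (-1 / 2) le_rfl (by norm_num)).const_mul _) |>.const_mul _)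
          (Eventually.of_forall fun t ↦ ?_)
        rw [hgn, show (1 - 3 / 2 : ℝ) = -1 / 2 by norm_num]
        obtain ⟨a, ha⟩ : ∃ a, a = ‖h ((3 / 2 : ℝ) + t * I)‖ := ⟨_, rfl⟩
        obtain ⟨b, hb⟩ : ∃ b, b = ‖h ((-1 / 2 : ℝ) + t * I)‖ := ⟨_, rfl⟩
        have hab : a * b ≤ l * a ^ 2 + l⁻¹ * b ^ 2 := by
          have h1 : l * a ^ 2 + l⁻¹ * b ^ 2 - a * b =
              l⁻¹ * ((l * a - b / 2) ^ 2 + 3 / 4 * b ^ 2) := by field_simp; ring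
          have h2 : 0 ≤ l⁻¹ * ((l * a - b / 2) ^ 2 + 3 / 4 * b ^ 2) := by positivity
          linarith
        rw [← ha, ← hb]
        calc _ ≤ Real.exp (9 / 4) * Real.exp (9 / 4) * (l * a ^ 2 + l⁻¹ * b ^ 2) *
              Real.exp (-(t ^ 2 / T ^ 2)) ^ 2 := by
              have b3 := hexp (3 / 2) (by norm_num) le_rfl
              have b4 := hexp (-1 / 2) le_rfl (by norm_num)
              have b5 : 0 ≤ a * b := by rw [ha, hb]; positivity
              gcongr ?_ * ?_ * ?_ * _
          _ ≤ Real.exp 5 * (l * a ^ 2 + l⁻¹ * b ^ 2) * Real.exp (-(t ^ 2 / T ^ 2)) ^ 2 := by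
              rw [← Real.exp_add]
              gcongr
              norm_num
          _ = _ := by ring
    _ = _ := by
        rw [integral_const_mul, integral_add ((hint (3 / 2) (by norm_num) le_rfl).const_mul _)
            ((hint (-1 / 2) le_rfl (by norm_num)).const_mul _), integral_const_mul,
            integral_const_mul]

lemma one_add_abs_pow_mul_gaussian_le {T : ℝ} (hT : 1 ≤ T) (t : ℝ) :
    (1 + |t|) ^ 4 * Real.exp (-(t ^ 2 / T ^ 2)) ≤ 4096 * T ^ 4 ∧
      (1 + |t|) ^ 8 * Real.exp (-(t ^ 2 / T ^ 2)) ≤ 4096 * T ^ 8 := by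
  have hT0 : 0 < T := by linarith
  have hT2 : 1 ≤ T ^ 2 := one_le_pow₀ hT
  obtain ⟨x, hx⟩ : ∃ x, x = t ^ 2 / T ^ 2 := ⟨_, rfl⟩
  have hx0 : 0 ≤ x := by rw [hx]; positivity
  have hxt : t ^ 2 = T ^ 2 * x := by rw [hx]; field_simp
  rw [← hx]
  obtain ⟨v, hv⟩ : ∃ v, v = Real.exp (x / 4) := ⟨_, rfl⟩
  have hv1 : 1 ≤ v := by rw [hv]; exact Real.one_le_exp (by positivity)
  have hvw : v ^ 4 * Real.exp (-x) = 1 := by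
    rw [hv, ← Real.exp_nat_mul, ← Real.exp_add, Real.exp_eq_one_iff]; push_cast; ring
  have hvw2 : v ^ 2 * Real.exp (-x) ≤ 1 := by
    rw [← hvw]
    exact mul_le_mul_of_nonneg_right (pow_le_pow_right₀ hv1 (by norm_num)) (Real.exp_pos _).le
  have hu : (1 + |t|) ^ 2 ≤ 8 * T ^ 2 * v := by
    have h1 : (1 + |t|) ^ 2 ≤ 2 * (1 + t ^ 2) := by
      nlinarith [sq_nonneg (1 - |t|), sq_abs t]
    have h2 : 1 + x ≤ 4 * v := by
      have := Real.add_one_le_exp (x / 4)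
      rw [← hv] at this; linarith
    calc (1 + |t|) ^ 2 ≤ 2 * (1 + t ^ 2) := h1
      _ ≤ 2 * (T ^ 2 * (1 + x)) := by rw [hxt]; nlinarith
      _ ≤ 2 * (T ^ 2 * (4 * v)) := by gcongr
      _ = _ := by ring
  constructor
  · calc _ = ((1 + |t|) ^ 2) ^ 2 * Real.exp (-x) := by ring
      _ ≤ (8 * T ^ 2 * v) ^ 2 * Real.exp (-x) := by gcongr
      _ = 64 * T ^ 4 * (v ^ 2 * Real.exp (-x)) := by ring
      _ ≤ 64 * T ^ 4 * 1 := by gcongr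
      _ ≤ _ := by nlinarith [pow_pos hT0 4]
  · calc _ = ((1 + |t|) ^ 2) ^ 4 * Real.exp (-x) := by ring
      _ ≤ (8 * T ^ 2 * v) ^ 4 * Real.exp (-x) := by gcongr
      _ = 4096 * T ^ 8 * (v ^ 4 * Real.exp (-x)) := by ring
      _ = _ := by rw [hvw, mul_one]

lemma integral_norm_sq_tsum_mul_gaussian_le_of_le {T B : ℝ} (hT : 1 ≤ T) {c : ℕ → ℂ} {u : ℕ → ℝ}
    (hc : Summable fun n ↦ ‖c n‖) (h0 : c 0 = 0) (hu : Summable u)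
    (hcu : ∀ n : ℕ, (T + n) * ‖c n‖ ^ 2 ≤ B * u n) :
    ∫ t : ℝ, ‖∑' n, c n * (n : ℂ) ^ (-(t * I))‖ ^ 2 * Real.exp (-(t ^ 2 / T ^ 2)) ≤
      √π * (8 + 64 * Real.exp 8) * (B * ∑' n, u n) := by
  have hs : Summable fun n : ℕ ↦ (T + n) * ‖c n‖ ^ 2 :=
    Summable.of_nonneg_of_le (fun n ↦ by positivity) hcu (hu.mul_left B)
  refine (integral_norm_sq_tsum_mul_gaussian_le hT hc h0 hs).trans ?_
  rw [← tsum_mul_left (a := B)]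
  exact mul_le_mul_of_nonneg_left (hs.tsum_le_tsum hcu (hu.mul_left B)) (by positivity)

lemma norm_mul_cpow_neg_sq {n : ℕ} (hn : n ≠ 0) (z : ℂ) (σ : ℝ) :
    ‖z * (n : ℂ) ^ (-(σ : ℂ))‖ ^ 2 = ‖z‖ ^ 2 * (n : ℝ) ^ (-(2 * σ)) := by
  rw [norm_mul, mul_pow, norm_natCast_cpow_of_pos (Nat.pos_of_ne_zero hn), ← Real.rpow_natCast,
    ← Real.rpow_natCast ((n : ℝ) ^ _), ← Real.rpow_mul (Nat.cast_nonneg n)]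
  simp only [neg_re, ofReal_re, Nat.cast_ofNat]
  ring_nf

lemma mul_cpow_neg_add {a : ℕ → ℂ} (h0 : a 0 = 0) (n : ℕ) (σ t : ℝ) :
    a n * (n : ℂ) ^ (-(σ + t * I : ℂ)) = a n * (n : ℂ) ^ (-(σ : ℂ)) * (n : ℂ) ^ (-(t * I)) := by
  rcases eq_or_ne n 0 with rfl | hn
  · simp [h0]
  · rw [neg_add, cpow_add _ _ (by exact_mod_cast hn), mul_assoc]

lemma rpow_one_div_log {T : ℝ} (hT : 3 ≤ T) : T ^ (1 / Real.log T) = Real.exp 1 := by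
  have h1 : 0 < Real.log T := Real.log_pos (by linarith)
  rw [Real.rpow_def_of_pos (by linarith), mul_one_div_cancel h1.ne']

lemma one_le_log {T : ℝ} (hT : 3 ≤ T) : 1 ≤ Real.log T := by
  rw [Real.le_log_iff_exp_le (by linarith)]
  linarith [Real.exp_one_lt_d9]

section DirichletPolynomial

variable {a : ℕ → ℂ} {T : ℝ}

lemma sum_range_floor_eq_tsum (h0 : a 0 = 0) (σ t : ℝ) :
    ∑ n ∈ range (⌊T⌋₊ + 1), a n * (n : ℂ) ^ (-(σ + t * I : ℂ)) =
      ∑' n : ℕ, (if n ≤ ⌊T⌋₊ then a n * (n : ℂ) ^ (-(σ : ℂ)) else 0) * (n : ℂ) ^ (-(t * I)) := by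
  rw [tsum_eq_sum (s := range (⌊T⌋₊ + 1)) fun n hn ↦ by
    rw [if_neg (by simpa [Nat.lt_succ_iff] using hn), zero_mul]]
  refine Finset.sum_congr rfl fun n hn ↦ ?_
  rw [if_pos (by simpa [Nat.lt_succ_iff] using hn), mul_cpow_neg_add h0]

lemma summable_norm_head (σ : ℝ) :
    Summable fun n : ℕ ↦ ‖if n ≤ ⌊T⌋₊ then a n * (n : ℂ) ^ (-(σ : ℂ)) else 0‖ :=
  summable_of_ne_finset_zero (s := range (⌊T⌋₊ + 1)) fun n hn ↦ by
    rw [if_neg (by simpa [Nat.lt_succ_iff] using hn), norm_zero]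

lemma integrable_head (hT : 3 ≤ T) (h0 : a 0 = 0) (σ : ℝ) :
    Integrable fun t : ℝ ↦ ‖∑ n ∈ range (⌊T⌋₊ + 1), a n * (n : ℂ) ^ (-(σ + t * I : ℂ))‖ ^ 2 *
      Real.exp (-(t ^ 2 / T ^ 2)) := by
  simp_rw [sum_range_floor_eq_tsum h0]
  exact integrable_norm_sq_tsum_mul_gaussian (by linarith) (summable_norm_head σ) (by simp [h0])

lemma integral_head_le (hT : 3 ≤ T) (h0 : a 0 = 0) {σ : ℝ} (hσ : σ ≤ 1 / 2)
    (hu : Summable fun n : ℕ ↦ ‖a n‖ ^ 2 * (n : ℝ) ^ (-(1 + 1 / Real.log T))) :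
    ∫ t : ℝ, ‖∑ n ∈ range (⌊T⌋₊ + 1), a n * (n : ℂ) ^ (-(σ + t * I : ℂ))‖ ^ 2 *
      Real.exp (-(t ^ 2 / T ^ 2)) ≤ √π * (8 + 64 * Real.exp 8) *
        (2 * Real.exp 1 * T ^ (2 - 2 * σ) *
          ∑' n : ℕ, ‖a n‖ ^ 2 * (n : ℝ) ^ (-(1 + 1 / Real.log T))) := by
  have hT0 : 0 < T := by linarith
  have hlog := one_le_log hT
  simp_rw [sum_range_floor_eq_tsum h0]
  refine integral_norm_sq_tsum_mul_gaussian_le_of_le (by linarith) (summable_norm_head σ)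
    (by simp [h0]) hu fun n ↦ ?_
  rcases eq_or_ne n 0 with rfl | hn
  · simp [h0]
  split_ifs with hnT
  · have hnT' : (n : ℝ) ≤ T := (Nat.cast_le.2 hnT).trans (Nat.floor_le hT0.le)
    have hn0 : (0 : ℝ) < n := by positivity
    have h1 : (n : ℝ) ^ (-(2 * σ)) = (n : ℝ) ^ (-(1 + 1 / Real.log T)) *
        (n : ℝ) ^ (1 - 2 * σ + 1 / Real.log T) := by
      rw [← Real.rpow_add hn0]; ring_nf
    have h2 : (n : ℝ) ^ (1 - 2 * σ + 1 / Real.log T) ≤ T ^ (1 - 2 * σ) * Real.exp 1 := by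
      rw [← rpow_one_div_log hT, ← Real.rpow_add hT0]
      have : 0 ≤ 1 / Real.log T := by positivity
      exact Real.rpow_le_rpow hn0.le hnT' (by linarith)
    have h3 : T ^ (2 - 2 * σ) = T * T ^ (1 - 2 * σ) := by
      rw [← Real.rpow_one_add' hT0.le (by linarith)]; ring_nf
    rw [norm_mul_cpow_neg_sq hn, h1, h3]
    calc _ ≤ (T + T) * (‖a n‖ ^ 2 * ((n : ℝ) ^ (-(1 + 1 / Real.log T)) *
          (T ^ (1 - 2 * σ) * Real.exp 1))) := by gcongr
      _ = _ := by ring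
  · rw [norm_zero, zero_pow two_ne_zero, mul_zero]
    positivity

lemma norm_term_eq {n : ℕ} (hn : n ≠ 0) :
    ‖LSeries.term a (3 / 2 : ℂ) n‖ = ‖a n * (n : ℂ) ^ (-((3 / 2 : ℝ) : ℂ))‖ := by
  rw [LSeries.term_of_ne_zero hn, cpow_neg, div_eq_mul_inv]; push_cast; rfl

lemma summable_norm_tail (ha : LSeriesSummable a (3 / 2)) :
    Summable fun n : ℕ ↦ ‖if n ≤ ⌊T⌋₊ then 0 else a n * (n : ℂ) ^ (-((3 / 2 : ℝ) : ℂ))‖ := by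
  refine Summable.of_nonneg_of_le (fun n ↦ norm_nonneg _) (fun n ↦ ?_) (Summable.norm ha)
  rcases eq_or_ne n 0 with rfl | hn
  · simp
  · rw [norm_term_eq hn]
    split_ifs
    · rw [norm_zero]; positivity
    · exact le_rfl

lemma LSeries_sub_sum_range_eq_tsum (ha : LSeriesSummable a (3 / 2)) (h0 : a 0 = 0) (t : ℝ) :
    LSeries a ((3 / 2 : ℝ) + t * I) -
        ∑ n ∈ range (⌊T⌋₊ + 1), a n * (n : ℂ) ^ (-((3 / 2 : ℝ) + t * I : ℂ)) =
      ∑' n : ℕ, (if n ≤ ⌊T⌋₊ then 0 else a n * (n : ℂ) ^ (-((3 / 2 : ℝ) : ℂ))) *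
        (n : ℂ) ^ (-(t * I)) := by
  have hs : Summable (LSeries.term a ((3 / 2 : ℝ) + t * I)) :=
    LSeriesSummable.of_re_le_re (by simp) ha
  rw [sum_range_floor_eq_tsum h0, LSeries, ← Summable.tsum_sub hs]
  · refine tsum_congr fun n ↦ ?_
    rcases eq_or_ne n 0 with rfl | hn
    · simp [h0]
    · rw [LSeries.term_of_ne_zero hn, div_eq_mul_inv, ← cpow_neg, mul_cpow_neg_add h0]
      split_ifs <;> simp
  · exact summable_of_ne_finset_zero (s := range (⌊T⌋₊ + 1)) fun n hn ↦ by
      rw [if_neg (by simpa [Nat.lt_succ_iff] using hn), zero_mul]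

lemma integrable_tail (hT : 3 ≤ T) (ha : LSeriesSummable a (3 / 2)) (h0 : a 0 = 0) :
    Integrable fun t : ℝ ↦ ‖LSeries a ((3 / 2 : ℝ) + t * I) -
        ∑ n ∈ range (⌊T⌋₊ + 1), a n * (n : ℂ) ^ (-((3 / 2 : ℝ) + t * I : ℂ))‖ ^ 2 *
      Real.exp (-(t ^ 2 / T ^ 2)) := by
  simp_rw [LSeries_sub_sum_range_eq_tsum ha h0]
  exact integrable_norm_sq_tsum_mul_gaussian (by linarith) (summable_norm_tail ha) (by simp)

lemma integral_tail_le (hT : 3 ≤ T) (ha : LSeriesSummable a (3 / 2)) (h0 : a 0 = 0)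
    (hu : Summable fun n : ℕ ↦ ‖a n‖ ^ 2 * (n : ℝ) ^ (-(1 + 1 / Real.log T))) :
    ∫ t : ℝ, ‖LSeries a ((3 / 2 : ℝ) + t * I) -
        ∑ n ∈ range (⌊T⌋₊ + 1), a n * (n : ℂ) ^ (-((3 / 2 : ℝ) + t * I : ℂ))‖ ^ 2 *
      Real.exp (-(t ^ 2 / T ^ 2)) ≤ √π * (8 + 64 * Real.exp 8) *
        (2 * Real.exp 1 * T⁻¹ * ∑' n : ℕ, ‖a n‖ ^ 2 * (n : ℝ) ^ (-(1 + 1 / Real.log T))) := by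
  have hT0 : 0 < T := by linarith
  have hlog := one_le_log hT
  simp_rw [LSeries_sub_sum_range_eq_tsum ha h0]
  refine integral_norm_sq_tsum_mul_gaussian_le_of_le (by linarith) (summable_norm_tail ha)
    (by simp) hu fun n ↦ ?_
  split_ifs with hnT
  · rw [norm_zero, zero_pow two_ne_zero, mul_zero]
    positivity
  · have hn : n ≠ 0 := by rintro rfl; simp at hnT
    have hnT' : T ≤ n := (Nat.lt_of_floor_lt (not_le.1 hnT)).le
    have hn0 : (0 : ℝ) < n := by positivity
    have h1 : (n : ℝ) * (n : ℝ) ^ (-(2 * (3 / 2 : ℝ))) = (n : ℝ) ^ (-(1 + 1 / Real.log T)) *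
        (n : ℝ) ^ (-1 + 1 / Real.log T) := by
      rw [← Real.rpow_add hn0, ← Real.rpow_one_add' hn0.le (by norm_num)]; ring_nf
    have h2 : (n : ℝ) ^ (-1 + 1 / Real.log T) ≤ T⁻¹ * Real.exp 1 := by
      rw [← rpow_one_div_log hT, ← Real.rpow_neg_one, ← Real.rpow_add hT0]
      have : 1 / Real.log T ≤ 1 := by rw [div_le_one (by linarith)]; exact hlog
      exact Real.rpow_le_rpow_of_nonpos hT0 hnT' (by linarith)
    rw [norm_mul_cpow_neg_sq hn]
    calc _ ≤ ((n : ℝ) + n) * (‖a n‖ ^ 2 * (n : ℝ) ^ (-(2 * (3 / 2 : ℝ)))) := by gcongr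
      _ = 2 * ‖a n‖ ^ 2 * ((n : ℝ) * (n : ℝ) ^ (-(2 * (3 / 2 : ℝ)))) := by ring
      _ = 2 * ‖a n‖ ^ 2 * ((n : ℝ) ^ (-(1 + 1 / Real.log T)) *
        (n : ℝ) ^ (-1 + 1 / Real.log T)) := by rw [h1]
      _ ≤ 2 * ‖a n‖ ^ 2 * ((n : ℝ) ^ (-(1 + 1 / Real.log T)) * (T⁻¹ * Real.exp 1)) := by gcongr
      _ = _ := by ring

end DirichletPolynomial

lemma StripExpBounded.conj_one_sub_conj {f : ℂ → ℂ} (hf : StripExpBounded f) :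
    StripExpBounded fun s ↦ starRingEnd ℂ (f (1 - starRingEnd ℂ s)) := by
  obtain ⟨C, hC⟩ := hf
  refine ⟨C, fun s h1 h2 ↦ ?_⟩
  have := hC (1 - starRingEnd ℂ s) (by simp; linarith) (by simp; linarith)
  rw [RCLike.norm_conj]
  simpa using this

lemma Differentiable.conj_one_sub_conj {f : ℂ → ℂ} (hf : Differentiable ℂ f) :
    Differentiable ℂ fun s ↦ starRingEnd ℂ (f (1 - starRingEnd ℂ s)) := fun s ↦ by
  have h3 : DifferentiableAt ℂ (fun z ↦ f (1 - z)) (starRingEnd ℂ s) := by fun_prop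
  have h4 := h3.conj_conj
  rw [conj_conj] at h4
  exact h4

lemma differentiable_sum_mul_cpow_neg {a : ℕ → ℂ} (h0 : a 0 = 0) (s : Finset ℕ) :
    Differentiable ℂ fun z : ℂ ↦ ∑ n ∈ s, a n * (n : ℂ) ^ (-z) := by
  refine Differentiable.fun_sum fun n _ ↦ ?_
  rcases eq_or_ne n 0 with rfl | hn
  · simp [h0]
  · have : NeZero (n : ℂ) := ⟨by exact_mod_cast hn⟩
    fun_prop

lemma stripExpBounded_sum_mul_cpow_neg {a : ℕ → ℂ} (h0 : a 0 = 0) (s : Finset ℕ) :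
    StripExpBounded fun z : ℂ ↦ ∑ n ∈ s, a n * (n : ℂ) ^ (-z) := by
  refine .sum _ fun n _ ↦ ?_
  rcases eq_or_ne n 0 with rfl | hn
  · simpa [h0] using StripExpBounded.const 0
  · have : NeZero n := ⟨hn⟩
    exact (StripExpBounded.const _).mul (stripExpBounded_natCast_cpow_neg n)

lemma one_sub_conj_add_mul_I (σ t : ℝ) :
    1 - starRingEnd ℂ (σ + t * I : ℂ) = ((1 - σ : ℝ) : ℂ) + t * I := by
  simp only [map_add, map_mul, conj_ofReal, conj_I, ofReal_sub, ofReal_one]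
  ring

set_option maxHeartbeats 1000000 in
/-- A second moment bound on the critical line for a function with a Dirichlet series and a
functional equation of degree two. -/
theorem exists_integral_norm_sq_le {E Y : ℂ → ℂ} {a : ℕ → ℂ} {C : ℝ} (hC : 0 ≤ C)
    (hE : Differentiable ℂ E) (hEb : StripExpBounded E)
    (hY : ∀ s : ℂ, s.re < 2 → DifferentiableAt ℂ Y s) (hYb : StripExpBounded Y)
    (hY1 : ∀ t : ℝ, ‖Y ((1 / 2 : ℝ) + t * I)‖ ≤ C * (1 + |t|) ^ 2)
    (hY3 : ∀ t : ℝ, ‖Y ((3 / 2 : ℝ) + t * I)‖ ≤ C)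
    (hYneg : ∀ t : ℝ, ‖Y ((-1 / 2 : ℝ) + t * I)‖ ≤ C * (1 + |t|) ^ 4)
    (h0 : a 0 = 0) (ha : LSeriesSummable a (3 / 2))
    (hE3 : ∀ t : ℝ, E ((3 / 2 : ℝ) + t * I) =
      ((1 / 2 : ℝ) + t * I) ^ 2 * LSeries a ((3 / 2 : ℝ) + t * I))
    (hEneg : ∀ t : ℝ, E ((-1 / 2 : ℝ) + t * I) =
      Y ((-1 / 2 : ℝ) + t * I) * starRingEnd ℂ (LSeries a ((3 / 2 : ℝ) + t * I))) :
    ∃ K : ℝ, ∀ T : ℝ, 3 ≤ T →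
      (Summable fun n : ℕ ↦ ‖a n‖ ^ 2 * (n : ℝ) ^ (-(1 + 1 / Real.log T))) →
      ∫ t in T..(2 * T), ‖E ((1 / 2 : ℝ) + t * I)‖ ^ 2 ≤
        K * (T ^ 5 * ∑' n : ℕ, ‖a n‖ ^ 2 * (n : ℝ) ^ (-(1 + 1 / Real.log T))) := by
  set M : ℝ := √π * (8 + 64 * Real.exp 8) with hM
  have hM0 : 0 ≤ M := by positivity
  refine ⟨2 * Real.exp 8 * (131072 * (1 + C ^ 2) * 8 * Real.exp 5 * M * Real.exp 1) +
    324 * (4 + C) ^ 2 * Real.exp 4 * M * Real.exp 1, fun T hT hu ↦ ?_⟩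
  have hT0 : 0 < T := by linarith
  have hT1 : 1 ≤ T := by linarith
  set A := ∑' n : ℕ, ‖a n‖ ^ 2 * (n : ℝ) ^ (-(1 + 1 / Real.log T)) with hA
  obtain ⟨D, hD⟩ : ∃ D : ℂ → ℂ, D = fun s ↦ ∑ n ∈ range (⌊T⌋₊ + 1), a n * (n : ℂ) ^ (-s) :=
    ⟨_, rfl⟩
  have hDd : Differentiable ℂ D := hD ▸ differentiable_sum_mul_cpow_neg h0 _
  have hDb : StripExpBounded D := hD ▸ stripExpBounded_sum_mul_cpow_neg h0 _
  obtain ⟨P, hP⟩ : ∃ P : ℝ → ℝ, P = fun t : ℝ ↦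
    ‖LSeries a ((3 / 2 : ℝ) + t * I) - D ((3 / 2 : ℝ) + t * I)‖ := ⟨_, rfl⟩
  obtain ⟨Q, hQ⟩ : ∃ Q : ℝ → ℝ, Q = fun t : ℝ ↦ ‖D ((-1 / 2 : ℝ) + t * I)‖ := ⟨_, rfl⟩
  obtain ⟨W, hW⟩ : ∃ W : ℝ → ℝ, W = fun t : ℝ ↦ Real.exp (-(t ^ 2 / T ^ 2)) := ⟨_, rfl⟩
  have hW0 : ∀ t, 0 < W t := fun t ↦ hW ▸ Real.exp_pos _
  have hP0 : ∀ t, 0 ≤ P t := fun t ↦ hP ▸ norm_nonneg _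
  have hQ0 : ∀ t, 0 ≤ Q t := fun t ↦ hQ ▸ norm_nonneg _
  have hW1 : ∀ t, W t ≤ 1 := fun t ↦ by
    rw [hW]; exact Real.exp_le_one_iff.2 (neg_nonpos.2 (by positivity))
  have hW4 : ∀ t, (1 + |t|) ^ 4 * W t ≤ 4096 * T ^ 4 := fun t ↦ by
    rw [hW]; exact (one_add_abs_pow_mul_gaussian_le hT1 t).1
  have hW8 : ∀ t, (1 + |t|) ^ 8 * W t ≤ 4096 * T ^ 8 := fun t ↦ by
    rw [hW]; exact (one_add_abs_pow_mul_gaussian_le hT1 t).2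
  have hPi : Integrable fun t ↦ P t ^ 2 * W t := by
    simp only [hP, hD, hW]; exact integrable_tail hT ha h0
  have hQi : Integrable fun t ↦ Q t ^ 2 * W t := by
    simp only [hQ, hD, hW]; exact integrable_head hT h0 _
  have hPI : ∫ t, P t ^ 2 * W t ≤ M * (2 * Real.exp 1 * T⁻¹ * A) := by
    simp only [hP, hD, hW]; exact integral_tail_le hT ha h0 hu
  have hQI : ∫ t, Q t ^ 2 * W t ≤ M * (2 * Real.exp 1 * T ^ 3 * A) := by
    simp only [hQ, hD, hW]
    have := integral_head_le hT h0 (σ := -1 / 2) (by norm_num) hu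
    rw [show (2 : ℝ) - 2 * (-1 / 2) = (3 : ℕ) by norm_num, Real.rpow_natCast] at this
    exact this
  obtain ⟨h, hh⟩ : ∃ h : ℂ → ℂ, h = fun s ↦ E s - (s - 1) * (s - 1) * D s -
    Y s * starRingEnd ℂ (D (1 - starRingEnd ℂ s)) := ⟨_, rfl⟩
  have hhd : ∀ s : ℂ, s.re < 2 → DifferentiableAt ℂ h s := fun s hs ↦ by
    rw [hh]
    exact ((hE s).sub (((differentiableAt_id.sub_const 1).mul
      (differentiableAt_id.sub_const 1)).mul (hDd s))).sub
      ((hY s hs).mul (hDd.conj_one_sub_conj s))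
  have hs1 : StripExpBounded fun s : ℂ ↦ s - 1 := StripExpBounded.id.sub (.const 1)
  have hhb : StripExpBounded h := hh ▸ (hEb.sub ((hs1.mul hs1).mul hDb)).sub
    (hYb.mul hDb.conj_one_sub_conj)
  have hsq : ∀ x y : ℝ, (x + y) ^ 2 ≤ 2 * (x ^ 2 + y ^ 2) := fun x y ↦ by
    nlinarith [sq_nonneg (x - y)]
  have hab : ∀ (σ t : ℝ), |σ| ≤ 2 → ‖((σ : ℂ) + t * I) ^ 2‖ ≤ 4 * (1 + |t|) ^ 2 :=
    fun σ t hσ ↦ by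
      rw [norm_pow]
      calc _ ≤ (2 * (1 + |t|)) ^ 2 := by gcongr; exact norm_add_mul_I_le σ t hσ
        _ = _ := by ring
  have hh3 : ∀ t : ℝ, ‖h ((3 / 2 : ℝ) + t * I)‖ ≤ 4 * (1 + |t|) ^ 2 * P t + C * Q t := fun t ↦ by
    have e : h ((3 / 2 : ℝ) + t * I) = ((1 / 2 : ℝ) + t * I) ^ 2 *
        (LSeries a ((3 / 2 : ℝ) + t * I) - D ((3 / 2 : ℝ) + t * I)) -
        Y ((3 / 2 : ℝ) + t * I) * starRingEnd ℂ (D ((-1 / 2 : ℝ) + t * I)) := by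
      rw [hh]
      simp only []
      rw [hE3, one_sub_conj_add_mul_I, show (1 - 3 / 2 : ℝ) = -1 / 2 by norm_num]
      push_cast
      ring
    rw [e]
    refine (norm_sub_le _ _).trans ?_
    rw [norm_mul, norm_mul, RCLike.norm_conj, hP, hQ]
    gcongr
    exacts [hab _ _ (by norm_num [abs_le]), hY3 t]
  have hhneg : ∀ t : ℝ, ‖h ((-1 / 2 : ℝ) + t * I)‖ ≤
      C * (1 + |t|) ^ 4 * P t + 4 * (1 + |t|) ^ 2 * Q t := fun t ↦ by
    have e : h ((-1 / 2 : ℝ) + t * I) = Y ((-1 / 2 : ℝ) + t * I) *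
        starRingEnd ℂ (LSeries a ((3 / 2 : ℝ) + t * I) - D ((3 / 2 : ℝ) + t * I)) -
        ((-3 / 2 : ℝ) + t * I) ^ 2 * D ((-1 / 2 : ℝ) + t * I) := by
      rw [hh]
      simp only []
      rw [hEneg, one_sub_conj_add_mul_I, show (1 - -1 / 2 : ℝ) = 3 / 2 by norm_num, map_sub]
      push_cast
      ring
    rw [e]
    refine (norm_sub_le _ _).trans ?_
    rw [norm_mul, norm_mul, RCLike.norm_conj, hP, hQ]
    gcongr
    exacts [hYneg t, hab _ _ (by norm_num [abs_le])]
  obtain ⟨K, hK⟩ : ∃ K, K = 131072 * (1 + C ^ 2) := ⟨_, rfl⟩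
  have hb3 : ∀ t : ℝ, ‖h ((3 / 2 : ℝ) + t * I)‖ ^ 2 * W t ^ 2 ≤
      K * (T ^ 4 * (P t ^ 2 * W t) + Q t ^ 2 * W t) := fun t ↦ by
    have := hW0 t
    calc _ ≤ (4 * (1 + |t|) ^ 2 * P t + C * Q t) ^ 2 * W t ^ 2 := by gcongr; exact hh3 t
      _ ≤ 2 * ((4 * (1 + |t|) ^ 2 * P t) ^ 2 + (C * Q t) ^ 2) * W t ^ 2 := by
          gcongr; exact hsq _ _
      _ = 32 * ((1 + |t|) ^ 4 * W t) * (P t ^ 2 * W t) +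
          2 * C ^ 2 * W t * (Q t ^ 2 * W t) := by ring
      _ ≤ 32 * (4096 * T ^ 4) * (P t ^ 2 * W t) + 2 * C ^ 2 * 1 * (Q t ^ 2 * W t) := by
          have h1 : 0 ≤ P t ^ 2 * W t := by positivity
          have h2 : 0 ≤ Q t ^ 2 * W t := by positivity
          exact add_le_add
            (mul_le_mul_of_nonneg_right (mul_le_mul_of_nonneg_left (hW4 t) (by positivity)) h1)
            (mul_le_mul_of_nonneg_right (mul_le_mul_of_nonneg_left (hW1 t) (by positivity)) h2)
      _ ≤ _ := by
          rw [hK]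
          have h1 : 0 ≤ T ^ 4 * (P t ^ 2 * W t) := by positivity
          have h2 : 0 ≤ Q t ^ 2 * W t := by positivity
          nlinarith [mul_nonneg (sq_nonneg C) h1, mul_nonneg (sq_nonneg C) h2]
  have hbneg : ∀ t : ℝ, ‖h ((-1 / 2 : ℝ) + t * I)‖ ^ 2 * W t ^ 2 ≤
      K * (T ^ 8 * (P t ^ 2 * W t) + T ^ 4 * (Q t ^ 2 * W t)) := fun t ↦ by
    have := hW0 t
    calc _ ≤ (C * (1 + |t|) ^ 4 * P t + 4 * (1 + |t|) ^ 2 * Q t) ^ 2 * W t ^ 2 := by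
          have := hP0 t
          have := hQ0 t
          gcongr; exact hhneg t
      _ ≤ 2 * ((C * (1 + |t|) ^ 4 * P t) ^ 2 + (4 * (1 + |t|) ^ 2 * Q t) ^ 2) * W t ^ 2 := by
          gcongr; exact hsq _ _
      _ = 2 * C ^ 2 * ((1 + |t|) ^ 8 * W t) * (P t ^ 2 * W t) +
          32 * ((1 + |t|) ^ 4 * W t) * (Q t ^ 2 * W t) := by ring
      _ ≤ 2 * C ^ 2 * (4096 * T ^ 8) * (P t ^ 2 * W t) +
          32 * (4096 * T ^ 4) * (Q t ^ 2 * W t) := by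
          have h1 : 0 ≤ P t ^ 2 * W t := by positivity
          have h2 : 0 ≤ Q t ^ 2 * W t := by positivity
          exact add_le_add
            (mul_le_mul_of_nonneg_right (mul_le_mul_of_nonneg_left (hW8 t) (by positivity)) h1)
            (mul_le_mul_of_nonneg_right (mul_le_mul_of_nonneg_left (hW4 t) (by positivity)) h2)
      _ ≤ _ := by
          rw [hK]
          have h1 : 0 ≤ T ^ 8 * (P t ^ 2 * W t) := by positivity
          have h2 : 0 ≤ T ^ 4 * (Q t ^ 2 * W t) := by positivity
          nlinarith [mul_nonneg (sq_nonneg C) h1, mul_nonneg (sq_nonneg C) h2]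
  obtain ⟨hhi, hhI⟩ := hhb.integral_norm_sq_half_le hhd hT1 (l := T ^ 2) (by positivity)
  have hWe : ∀ t : ℝ, Real.exp (-(t ^ 2 / T ^ 2)) = W t := fun t ↦ by rw [hW]
  simp_rw [hWe] at hhi hhI
  have hK0 : 0 ≤ K := by rw [hK]; positivity
  have hI3 : ∫ t : ℝ, ‖h ((3 / 2 : ℝ) + t * I)‖ ^ 2 * W t ^ 2 ≤
      K * (T ^ 4 * (M * (2 * Real.exp 1 * T⁻¹ * A)) + M * (2 * Real.exp 1 * T ^ 3 * A)) := by
    calc _ ≤ ∫ t, K * (T ^ 4 * (P t ^ 2 * W t) + Q t ^ 2 * W t) :=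
          integral_mono (hhi _ (by norm_num) le_rfl) (((hPi.const_mul _).add hQi).const_mul K) hb3
      _ = K * (T ^ 4 * (∫ t, P t ^ 2 * W t) + ∫ t, Q t ^ 2 * W t) := by
          rw [integral_const_mul, integral_add (hPi.const_mul _) hQi, integral_const_mul]
      _ ≤ _ := by gcongr
  have hIneg : ∫ t : ℝ, ‖h ((-1 / 2 : ℝ) + t * I)‖ ^ 2 * W t ^ 2 ≤
      K * (T ^ 8 * (M * (2 * Real.exp 1 * T⁻¹ * A)) +
        T ^ 4 * (M * (2 * Real.exp 1 * T ^ 3 * A))) := by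
    calc _ ≤ ∫ t, K * (T ^ 8 * (P t ^ 2 * W t) + T ^ 4 * (Q t ^ 2 * W t)) :=
          integral_mono (hhi _ le_rfl (by norm_num))
            (((hPi.const_mul _).add (hQi.const_mul _)).const_mul K) hbneg
      _ = K * (T ^ 8 * (∫ t, P t ^ 2 * W t) + T ^ 4 * ∫ t, Q t ^ 2 * W t) := by
          rw [integral_const_mul, integral_add (hPi.const_mul _) (hQi.const_mul _),
            integral_const_mul, integral_const_mul]
      _ ≤ _ := by gcongr
  have hI1 : ∫ t : ℝ, ‖h ((1 / 2 : ℝ) + t * I)‖ ^ 2 * W t ^ 2 ≤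
      K * 8 * Real.exp 5 * M * Real.exp 1 * (T ^ 5 * A) := by
    refine hhI.trans ?_
    calc _ ≤ Real.exp 5 * (T ^ 2 * (K * (T ^ 4 * (M * (2 * Real.exp 1 * T⁻¹ * A)) +
          M * (2 * Real.exp 1 * T ^ 3 * A))) + (T ^ 2)⁻¹ *
          (K * (T ^ 8 * (M * (2 * Real.exp 1 * T⁻¹ * A)) +
          T ^ 4 * (M * (2 * Real.exp 1 * T ^ 3 * A))))) := by gcongr
      _ = _ := by field_simp; ring
  have hDi : Integrable fun t : ℝ ↦ ‖D ((1 / 2 : ℝ) + t * I)‖ ^ 2 * W t := by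
    simp only [hD, hW]; exact integrable_head hT h0 _
  have hDI : ∫ t : ℝ, ‖D ((1 / 2 : ℝ) + t * I)‖ ^ 2 * W t ≤ M * (2 * Real.exp 1 * T * A) := by
    simp only [hD, hW]
    have := integral_head_le hT h0 (σ := 1 / 2) (by norm_num) hu
    rw [show (2 : ℝ) - 2 * (1 / 2) = 1 by norm_num, Real.rpow_one] at this
    exact this
  have hE1 : ∀ t : ℝ, ‖E ((1 / 2 : ℝ) + t * I)‖ ≤ ‖h ((1 / 2 : ℝ) + t * I)‖ +
      (4 + C) * (1 + |t|) ^ 2 * ‖D ((1 / 2 : ℝ) + t * I)‖ := fun t ↦ by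
    have e : E ((1 / 2 : ℝ) + t * I) = h ((1 / 2 : ℝ) + t * I) +
        (((-1 / 2 : ℝ) + t * I) ^ 2 * D ((1 / 2 : ℝ) + t * I) +
        Y ((1 / 2 : ℝ) + t * I) * starRingEnd ℂ (D ((1 / 2 : ℝ) + t * I))) := by
      rw [hh]
      simp only []
      rw [one_sub_conj_add_mul_I, show (1 - 1 / 2 : ℝ) = 1 / 2 by norm_num]
      push_cast
      ring
    rw [e]
    refine (norm_add_le _ _).trans ?_
    gcongr
    refine (norm_add_le _ _).trans ?_
    rw [norm_mul, norm_mul, RCLike.norm_conj, ← add_mul, add_mul 4 C]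
    gcongr
    exacts [hab _ _ (by norm_num [abs_le]), hY1 t]
  have hpt : ∀ t ∈ Set.Ioc T (2 * T), ‖E ((1 / 2 : ℝ) + t * I)‖ ^ 2 ≤
      2 * Real.exp 8 * (‖h ((1 / 2 : ℝ) + t * I)‖ ^ 2 * W t ^ 2) +
      162 * (4 + C) ^ 2 * Real.exp 4 * T ^ 4 * (‖D ((1 / 2 : ℝ) + t * I)‖ ^ 2 * W t) :=
    fun t ht ↦ by
      have ht0 : 0 < t := hT0.trans ht.1
      have h4 : 1 ≤ Real.exp 4 * W t := by
        rw [hW, ← Real.exp_add]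
        refine Real.one_le_exp ?_
        have : t ^ 2 / T ^ 2 ≤ 4 := by
          rw [div_le_iff₀ (by positivity)]; nlinarith [ht.2]
        linarith
      have h8 : 1 ≤ Real.exp 8 * W t ^ 2 := by
        rw [show Real.exp 8 * W t ^ 2 = (Real.exp 4 * W t) ^ 2 by
          rw [mul_pow, ← Real.exp_nat_mul]; norm_num]
        exact one_le_pow₀ h4
      have ht3 : 1 + |t| ≤ 3 * T := by rw [abs_of_pos ht0]; linarith [ht.2]
      calc _ ≤ (‖h ((1 / 2 : ℝ) + t * I)‖ +
            (4 + C) * (1 + |t|) ^ 2 * ‖D ((1 / 2 : ℝ) + t * I)‖) ^ 2 := by gcongr; exact hE1 t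
        _ ≤ 2 * (‖h ((1 / 2 : ℝ) + t * I)‖ ^ 2 +
            ((4 + C) * (1 + |t|) ^ 2 * ‖D ((1 / 2 : ℝ) + t * I)‖) ^ 2) := hsq _ _
        _ ≤ 2 * (‖h ((1 / 2 : ℝ) + t * I)‖ ^ 2 +
            ((4 + C) * (3 * T) ^ 2 * ‖D ((1 / 2 : ℝ) + t * I)‖) ^ 2) := by gcongr
        _ = 2 * ‖h ((1 / 2 : ℝ) + t * I)‖ ^ 2 * 1 +
            162 * (4 + C) ^ 2 * T ^ 4 * ‖D ((1 / 2 : ℝ) + t * I)‖ ^ 2 * 1 := by ring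
        _ ≤ 2 * ‖h ((1 / 2 : ℝ) + t * I)‖ ^ 2 * (Real.exp 8 * W t ^ 2) +
            162 * (4 + C) ^ 2 * T ^ 4 * ‖D ((1 / 2 : ℝ) + t * I)‖ ^ 2 * (Real.exp 4 * W t) := by
            gcongr
        _ = _ := by ring
  have hhi1 := hhi (1 / 2) (by norm_num) (by norm_num)
  have hcont : Continuous fun t : ℝ ↦ ‖E ((1 / 2 : ℝ) + t * I)‖ ^ 2 :=
    ((hE.continuous.comp (by fun_prop)).norm).pow 2
  have hRi := (hhi1.const_mul (2 * Real.exp 8)).add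
    (hDi.const_mul (162 * (4 + C) ^ 2 * Real.exp 4 * T ^ 4))
  rw [intervalIntegral.integral_of_le (by linarith)]
  calc _ ≤ ∫ t : ℝ in Set.Ioc T (2 * T),
      2 * Real.exp 8 * (‖h ((1 / 2 : ℝ) + t * I)‖ ^ 2 * W t ^ 2) +
      162 * (4 + C) ^ 2 * Real.exp 4 * T ^ 4 * (‖D ((1 / 2 : ℝ) + t * I)‖ ^ 2 * W t) :=
        setIntegral_mono_on (hcont.integrableOn_Ioc) hRi.integrableOn measurableSet_Ioc hpt
    _ ≤ ∫ t : ℝ, 2 * Real.exp 8 * (‖h ((1 / 2 : ℝ) + t * I)‖ ^ 2 * W t ^ 2) +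
      162 * (4 + C) ^ 2 * Real.exp 4 * T ^ 4 * (‖D ((1 / 2 : ℝ) + t * I)‖ ^ 2 * W t) := by
        refine setIntegral_le_integral hRi (Eventually.of_forall fun t ↦ ?_)
        have := hW0 t
        simp only [Pi.zero_apply]
        positivity
    _ = 2 * Real.exp 8 * (∫ t : ℝ, ‖h ((1 / 2 : ℝ) + t * I)‖ ^ 2 * W t ^ 2) +
      162 * (4 + C) ^ 2 * Real.exp 4 * T ^ 4 *
        ∫ t : ℝ, ‖D ((1 / 2 : ℝ) + t * I)‖ ^ 2 * W t := by
        rw [integral_add (hhi1.const_mul _) (hDi.const_mul _), integral_const_mul,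
          integral_const_mul]
    _ ≤ 2 * Real.exp 8 * (K * 8 * Real.exp 5 * M * Real.exp 1 * (T ^ 5 * A)) +
      162 * (4 + C) ^ 2 * Real.exp 4 * T ^ 4 * (M * (2 * Real.exp 1 * T * A)) := by gcongr
    _ = _ := by rw [hK]; ring

lemma half_add_mul_I_ne_one (t : ℝ) : (1 / 2 + t * I : ℂ) ≠ 1 := fun h ↦ by
  have := congrArg Complex.re h
  norm_num at this

lemma continuous_LFunction_half {N : ℕ} [NeZero N] (χ : DirichletCharacter ℂ N) :
    Continuous fun t : ℝ ↦ χ.LFunction (1 / 2 + t * I) :=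
  continuous_iff_continuousAt.2 fun t ↦ ContinuousAt.comp (f := fun t : ℝ ↦ (1 / 2 + t * I : ℂ))
    (χ.differentiableAt_LFunction _ (.inl (half_add_mul_I_ne_one t))).continuousAt (by fun_prop)

/-- The mean square on the critical line of the product of the `L`-functions of two primitive
characters which are not induced from one another. -/
theorem exists_integral_norm_sq_LFunction_mul_le {M N : ℕ} [NeZero M] [NeZero N]
    {χ : DirichletCharacter ℂ M} {ν : DirichletCharacter ℂ N} (hχ : χ.IsPrimitive)
    (hν : ν.IsPrimitive) (hne : DirichletCharacter.changeLevel (M.dvd_mul_right N) χ ≠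
      DirichletCharacter.changeLevel (N.dvd_mul_left M) ν) :
    ∃ K : ℝ, ∀ T : ℝ, 3 ≤ T →
      ∫ t in T..(2 * T), ‖χ.LFunction (1 / 2 + t * I) * ν.LFunction (1 / 2 + t * I)‖ ^ 2 ≤
        K * T * Real.log T ^ 2 := by
  obtain ⟨E₁, Y₁, C₁, h₁⟩ := exists_isFunctionalEquationPair hχ
  obtain ⟨E₂, Y₂, C₂, h₂⟩ := exists_isFunctionalEquationPair hν
  obtain ⟨C, hC⟩ := exists_tsum_norm_convolution_sq_le χ ν hne
  have e12 : ((1 / 2 : ℝ) : ℂ) = 1 / 2 := by push_cast; rfl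
  have e32 : ((3 / 2 : ℝ) : ℂ) = 3 / 2 := by push_cast; rfl
  have en2 : ((-1 / 2 : ℝ) : ℂ) = -1 / 2 := by push_cast; rfl
  have hre (t : ℝ) : 1 < (3 / 2 + t * I : ℂ).re := by norm_num
  have hL (t : ℝ) : LSeries (LSeries.convolution (χ ·) (ν ·)) (3 / 2 + t * I) =
      χ.LFunction (3 / 2 + t * I) * ν.LFunction (3 / 2 + t * I) := by
    rw [χ.LFunction_eq_LSeries (hre t), ν.LFunction_eq_LSeries (hre t),
      LSeries_convolution' (DirichletCharacter.LSeriesSummable_of_one_lt_re χ (hre t))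
        (DirichletCharacter.LSeriesSummable_of_one_lt_re ν (hre t))]
  obtain ⟨K, hK⟩ := exists_integral_norm_sq_le (E := fun s ↦ E₁ s * E₂ s)
    (Y := fun s ↦ Y₁ s * Y₂ s) (a := LSeries.convolution (χ ·) (ν ·)) (C := C₁ * C₂)
    (mul_nonneg h₁.nonneg h₂.nonneg)
    (h₁.differentiable.mul h₂.differentiable) (h₁.stripExpBounded.mul h₂.stripExpBounded)
    (fun s hs ↦ (h₁.differentiableAt_factor s hs).mul (h₂.differentiableAt_factor s hs))
    (h₁.stripExpBounded_factor.mul h₂.stripExpBounded_factor)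
    (fun t ↦ by
      rw [e12, norm_mul]
      calc _ ≤ C₁ * (1 + |t|) * (C₂ * (1 + |t|)) :=
            mul_le_mul (h₁.norm_factor_half t) (h₂.norm_factor_half t) (norm_nonneg _)
              ((norm_nonneg _).trans (h₁.norm_factor_half t))
        _ = _ := by ring)
    (fun t ↦ by
      rw [e32, norm_mul]
      exact mul_le_mul (h₁.norm_factor_three_halves t) (h₂.norm_factor_three_halves t)
        (norm_nonneg _) h₁.nonneg)
    (fun t ↦ by
      rw [en2, norm_mul]
      calc _ ≤ C₁ * (1 + |t|) ^ 2 * (C₂ * (1 + |t|) ^ 2) :=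
            mul_le_mul (h₁.norm_factor_neg_half t) (h₂.norm_factor_neg_half t) (norm_nonneg _)
              ((norm_nonneg _).trans (h₁.norm_factor_neg_half t))
        _ = _ := by ring)
    (LSeries.convolution_map_zero _ _)
    (.convolution (DirichletCharacter.LSeriesSummable_of_one_lt_re χ (by norm_num))
      (DirichletCharacter.LSeriesSummable_of_one_lt_re ν (by norm_num)))
    (fun t ↦ by
      have h1 : (3 / 2 + t * I : ℂ) ≠ 1 := fun h ↦ by
        have := congrArg Complex.re h
        norm_num at this
      rw [e12, e32, hL, h₁.eq_LFunction _ h1, h₂.eq_LFunction _ h1]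
      ring)
    (fun t ↦ by
      rw [en2, e32, hL, h₁.eq_factor_mul, h₂.eq_factor_mul, map_mul]
      ring)
  refine ⟨|K| * C, fun T hT ↦ ?_⟩
  have hT0 : 0 < T := by linarith
  have hlog := one_le_log hT
  obtain ⟨hs, hle⟩ := hC (1 / Real.log T) (by positivity) 
    (by rw [div_le_one₀ (by positivity)]; exact hlog)
  have hint := hK T hT hs
  have hA : 0 ≤
      ∑' n : ℕ, ‖LSeries.convolution (χ ·) (ν ·) n‖ ^ 2 * (n : ℝ) ^ (-(1 + 1 / Real.log T)) :=
    tsum_nonneg fun n ↦ by positivity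
  have hpt : ∀ t ∈ Set.Icc T (2 * T),
      T ^ 4 * ‖χ.LFunction (1 / 2 + t * I) * ν.LFunction (1 / 2 + t * I)‖ ^ 2 ≤
        ‖E₁ ((1 / 2 : ℝ) + t * I) * E₂ ((1 / 2 : ℝ) + t * I)‖ ^ 2 := fun t ht ↦ by
    have h1 := half_add_mul_I_ne_one t
    have h2 : T ≤ ‖(1 / 2 + t * I - 1 : ℂ)‖ := by
      refine (ht.1.trans (le_abs_self t)).trans ?_
      simpa using abs_im_le_norm (1 / 2 + t * I - 1 : ℂ)
    rw [e12, h₁.eq_LFunction _ h1, h₂.eq_LFunction _ h1, mul_mul_mul_comm, norm_mul _ (_ * _),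
      mul_pow, norm_mul (_ - _)]
    refine mul_le_mul_of_nonneg_right ?_ (by positivity)
    calc T ^ 4 = (T * T) ^ 2 := by ring
      _ ≤ _ := by gcongr
  have hcL := ((continuous_LFunction_half χ).mul (continuous_LFunction_half ν)).norm.pow 2
  have hcE : Continuous fun t : ℝ ↦
      ‖E₁ ((1 / 2 : ℝ) + t * I) * E₂ ((1 / 2 : ℝ) + t * I)‖ ^ 2 :=
    (((h₁.differentiable.mul h₂.differentiable).continuous.comp
      (g := fun s ↦ E₁ s * E₂ s) (f := fun t : ℝ ↦ ((1 / 2 : ℝ) + t * I : ℂ))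
      (by fun_prop)).norm).pow 2
  have hmono := intervalIntegral.integral_mono_on (μ := volume) (by linarith)
    ((hcL.const_mul (T ^ 4)).intervalIntegrable T (2 * T)) (hcE.intervalIntegrable T (2 * T)) hpt
  rw [intervalIntegral.integral_const_mul] at hmono
  have hfin : T ^ 4 * ∫ t in T..(2 * T),
      ‖χ.LFunction (1 / 2 + t * I) * ν.LFunction (1 / 2 + t * I)‖ ^ 2 ≤
      T ^ 4 * (|K| * C * T * Real.log T ^ 2) := by
    refine hmono.trans (hint.trans ?_)
    calc _ ≤ |K| * (T ^ 5 * (C / (1 / Real.log T) ^ 2)) :=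
          mul_le_mul (le_abs_self K) (by gcongr) (by positivity) (abs_nonneg K)
      _ = _ := by field_simp
  exact le_of_mul_le_mul_left hfin (by positivity)

lemma norm_one_sub_mul_natCast_cpow_neg_le {N : ℕ} (χ : DirichletCharacter ℂ N) {p : ℕ}
    (hp : 0 < p) {s : ℂ} (hs : 0 ≤ s.re) : ‖1 - χ p * (p : ℂ) ^ (-s)‖ ≤ 2 := by
  have h1 : ‖(p : ℂ) ^ (-s)‖ ≤ 1 := by
    rw [norm_natCast_cpow_of_pos hp]
    exact Real.rpow_le_one_of_one_le_of_nonpos (by exact_mod_cast hp) (by simpa using hs)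
  calc _ ≤ ‖(1 : ℂ)‖ + ‖χ p * (p : ℂ) ^ (-s)‖ := norm_sub_le _ _
    _ ≤ 1 + 1 * 1 := by
      rw [norm_one, norm_mul]
      gcongr
      exact χ.norm_le_one _
    _ = 2 := by norm_num

lemma norm_LFunction_le_primitiveCharacter {q : ℕ} [NeZero q] (χ : DirichletCharacter ℂ q)
    [NeZero χ.conductor] {s : ℂ} (hs : 0 ≤ s.re) (h1 : s ≠ 1) :
    ‖χ.LFunction s‖ ≤ ‖χ.primitiveCharacter.LFunction s‖ * 2 ^ #q.primeFactors := by
  conv_lhs => rw [← χ.changeLevel_primitiveCharacter,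
    DirichletCharacter.LFunction_changeLevel _ _ (.inr h1), norm_mul, norm_prod]
  gcongr
  rw [← Finset.prod_const]
  exact Finset.prod_le_prod (fun _ _ ↦ norm_nonneg _) fun p hp ↦
    norm_one_sub_mul_natCast_cpow_neg_le _ (Nat.pos_of_mem_primeFactors hp) hs

lemma changeLevel_primitiveCharacter_ne {q : ℕ} [NeZero q] {χ ν : DirichletCharacter ℂ q}
    (hne : χ ≠ ν) :
    DirichletCharacter.changeLevel (χ.conductor.dvd_mul_right ν.conductor) χ.primitiveCharacter ≠
      DirichletCharacter.changeLevel (ν.conductor.dvd_mul_left χ.conductor)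
        ν.primitiveCharacter := fun h ↦ hne <| by
  have h1 := χ.conductor_ne_zero
  have h2 := ν.conductor_ne_zero
  have : NeZero (q * (χ.conductor * ν.conductor)) :=
    ⟨mul_ne_zero (NeZero.ne q) (mul_ne_zero h1 h2)⟩
  refine DirichletCharacter.changeLevel_injective
    (q.dvd_mul_right (χ.conductor * ν.conductor)) ?_
  have h3 := congrArg (DirichletCharacter.changeLevel
    ((χ.conductor * ν.conductor).dvd_mul_left q)) h
  rw [← DirichletCharacter.changeLevel_trans, ← DirichletCharacter.changeLevel_trans] at h3
  have h4 (ψ : DirichletCharacter ℂ q) :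
      DirichletCharacter.changeLevel (q.dvd_mul_right (χ.conductor * ν.conductor)) ψ =
        DirichletCharacter.changeLevel (ψ.conductor_dvd_level.trans
          (q.dvd_mul_right (χ.conductor * ν.conductor))) ψ.primitiveCharacter := by
    rw [DirichletCharacter.changeLevel_trans _ ψ.conductor_dvd_level,
      DirichletCharacter.changeLevel_primitiveCharacter]
  rw [h4, h4]
  exact h3

/-- Off-diagonal bound: for distinct characters `χ, ν` modulo `q`,
`|∫_T^{2T} L(1/2+it,χ)² conj(L(1/2+it,ν))² dt| ≪_q T (log T)²`. -/
theorem major_offdiagonal_bound (q : ℕ) [NeZero q] (χ ν : DirichletCharacter ℂ q) (hne : χ ≠ ν) :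
    ∃ C T₀ : ℝ, ∀ T : ℝ, T₀ ≤ T →
      ‖∫ t in T..(2*T),
          (DirichletCharacter.LFunction χ (1/2 + t * Complex.I)) ^ 2 *
            (starRingEnd ℂ (DirichletCharacter.LFunction ν (1/2 + t * Complex.I))) ^ 2‖
        ≤ C * T * Real.log T ^ 2 := by
  have : NeZero χ.conductor := ⟨χ.conductor_ne_zero⟩
  have : NeZero ν.conductor := ⟨ν.conductor_ne_zero⟩
  obtain ⟨K, hK⟩ := exists_integral_norm_sq_LFunction_mul_le χ.primitiveCharacter_isPrimitive
    ν.primitiveCharacter_isPrimitive (changeLevel_primitiveCharacter_ne hne)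
  refine ⟨(2 ^ #q.primeFactors) ^ 4 * K, 3, fun T hT ↦ ?_⟩
  have hpt (t : ℝ) : ‖χ.LFunction (1 / 2 + t * I) ^ 2 *
      starRingEnd ℂ (ν.LFunction (1 / 2 + t * I)) ^ 2‖ ≤ (2 ^ #q.primeFactors) ^ 4 *
        ‖χ.primitiveCharacter.LFunction (1 / 2 + t * I) *
          ν.primitiveCharacter.LFunction (1 / 2 + t * I)‖ ^ 2 := by
    have hre : 0 ≤ (1 / 2 + t * I : ℂ).re := by norm_num
    have h1 := half_add_mul_I_ne_one t
    rw [norm_mul, norm_pow, norm_pow, RCLike.norm_conj, norm_mul]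
    calc _ ≤ (‖χ.primitiveCharacter.LFunction (1 / 2 + t * I)‖ * 2 ^ #q.primeFactors) ^ 2 *
          (‖ν.primitiveCharacter.LFunction (1 / 2 + t * I)‖ * 2 ^ #q.primeFactors) ^ 2 :=
          mul_le_mul (pow_le_pow_left₀ (norm_nonneg _)
            (norm_LFunction_le_primitiveCharacter χ hre h1) 2) (pow_le_pow_left₀ (norm_nonneg _)
            (norm_LFunction_le_primitiveCharacter ν hre h1) 2) (by positivity) (by positivity)
      _ = _ := by ring
  have hcL := ((continuous_LFunction_half χ.primitiveCharacter).mul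
    (continuous_LFunction_half ν.primitiveCharacter)).norm.pow 2
  refine (intervalIntegral.norm_integral_le_of_norm_le (by linarith)
    (Eventually.of_forall fun t _ ↦ hpt t)
    ((hcL.const_mul _).intervalIntegrable T (2 * T))).trans ?_
  rw [intervalIntegral.integral_const_mul]
  calc _ ≤ (2 ^ #q.primeFactors) ^ 4 * (K * T * Real.log T ^ 2) := by gcongr; exact hK T hT
    _ = _ := by ring
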